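/- arXiv:2510.13258 — 4 statements merged into one kernel-verified Lean document; each statement's English description precedes it below -/
import Mathlib

section
/- For every n ≥ 1, the map θ defined as follows is a bijection from 𝒞𝒪_{2n+2} onto 𝔇_{2n}: given π = π_1π_2⋯π_{2n+2} ∈ 𝒞𝒪_{2n+2}, let θ(π) be the word σ = σ_1⋯σ_{2n} with σ_{2i−1} := π_{n+i+1} − 1 and σ_{2i} := π_{i+1} − 1 for 1 ≤ i ≤ n; then σ is a permutation of {1,…,2n} belonging to 𝔇_{2n}, and every element of 𝔇_{2n} arises exactly once in this way. -/
/-- A permutation `π` of `{1, …, 2m}` is collapsed if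
`1 + ⌊k/2⌋ ≤ π⁻¹(k) ≤ m + ⌊k/2⌋` for every `k ∈ {1, …, 2m}`
(positions and values are 1-indexed: the value `k` corresponds to the
index `⟨k-1, _⟩`, and the position of `k` is `(π.symm ⟨k-1, _⟩ : ℕ) + 1`). -/
def IsCollapsed (m : ℕ) (π : Equiv.Perm (Fin (2 * m))) : Prop :=
  ∀ k : Fin (2 * m),
    1 + ((k : ℕ) + 1) / 2 ≤ (π.symm k : ℕ) + 1 ∧
    (π.symm k : ℕ) + 1 ≤ m + ((k : ℕ) + 1) / 2

/-- A D-permutation of `{1, …, m}`: `σ(2i) ≤ 2i` and `σ(2i-1) ≥ 2i-1` for all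
applicable `i`; i.e. `σ(p) ≤ p` at even `p` and `σ(p) ≥ p` at odd `p`
(1-indexed: the point `p` corresponds to the index `i` with `p = (i : ℕ) + 1`). -/
def IsDPerm {m : ℕ} (σ : Equiv.Perm (Fin m)) : Prop :=
  ∀ i : Fin m, (Even ((i : ℕ) + 1) → σ i ≤ i) ∧ (Odd ((i : ℕ) + 1) → i ≤ σ i)

/-- The defining relation of the map `θ`: for `π = π_1 ⋯ π_{2n+2}` collapsed,
`θ(π) = σ = σ_1 ⋯ σ_{2n}` with `σ_{2i-1} = π_{n+i+1} - 1` and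
`σ_{2i} = π_{i+1} - 1` for `1 ≤ i ≤ n` (entries 1-indexed; the entry at
position `p` of `π` is `(π ⟨p-1, _⟩ : ℕ) + 1`). -/
def ThetaRel (n : ℕ) (π : Equiv.Perm (Fin (2 * (n + 1))))
    (σ : Equiv.Perm (Fin (2 * n))) : Prop :=
  ∀ i : ℕ, ∀ _hi : 1 ≤ i, ∀ _hin : i ≤ n,
    ((σ ⟨2 * i - 2, by omega⟩ : ℕ) + 1 = (π ⟨n + i, by omega⟩ : ℕ)) ∧
    ((σ ⟨2 * i - 1, by omega⟩ : ℕ) + 1 = (π ⟨i, by omega⟩ : ℕ))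

lemma collapsed_iff (n : ℕ) (π : Equiv.Perm (Fin (2 * (n + 1)))) :
    IsCollapsed (n + 1) π ↔ ∀ p, ((π p : ℕ) + 1) / 2 ≤ p ∧ (p : ℕ) ≤ n + ((π p : ℕ) + 1) / 2 := by
  constructor
  · intro h p
    have := h (π p)
    rw [Equiv.symm_apply_apply] at this
    omega
  · intro h k
    have := h (π.symm k)
    rw [Equiv.apply_symm_apply] at this
    omega

lemma collapsed_zero (n : ℕ) (π : Equiv.Perm (Fin (2 * (n + 1)))) (h : IsCollapsed (n + 1) π) :
    π ⟨0, by omega⟩ = ⟨0, by omega⟩ := by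
  have h := (collapsed_iff n π).1 h
  obtain ⟨p, hp⟩ := π.surjective ⟨0, by omega⟩
  have h0 := (h ⟨0, by omega⟩).1
  apply Fin.ext
  simp only at h0 ⊢
  omega

lemma collapsed_last (n : ℕ) (π : Equiv.Perm (Fin (2 * (n + 1)))) (h : IsCollapsed (n + 1) π) :
    π ⟨2 * n + 1, by omega⟩ = ⟨2 * n + 1, by omega⟩ := by
  have h := (collapsed_iff n π).1 h
  have h0 := (h ⟨2 * n + 1, by omega⟩).2
  apply Fin.ext
  simp only at h0 ⊢
  omega

/-- position map -/
def posMap (n : ℕ) (j : Fin (2 * n)) : Fin (2 * (n + 1)) :=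
  if (j : ℕ) % 2 = 0 then ⟨n + 1 + j / 2, by omega⟩ else ⟨(j + 1) / 2, by omega⟩

lemma posMap_val (n : ℕ) (j : Fin (2 * n)) :
    ((j : ℕ) % 2 = 0 ∧ (posMap n j : ℕ) = n + 1 + j / 2) ∨
    ((j : ℕ) % 2 = 1 ∧ (posMap n j : ℕ) = (j + 1) / 2) := by
  unfold posMap
  split_ifs with h
  · exact Or.inl ⟨h, rfl⟩
  · exact Or.inr ⟨by omega, rfl⟩

lemma posMap_inj (n : ℕ) : Function.Injective (posMap n) := by
  intro a b hab
  have h := congrArg Fin.val hab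
  apply Fin.ext
  rcases posMap_val n a with ⟨h1, h2⟩ | ⟨h1, h2⟩ <;>
  rcases posMap_val n b with ⟨h3, h4⟩ | ⟨h3, h4⟩ <;> omega

lemma posMap_surj (n : ℕ) (p : Fin (2 * (n + 1))) (h0 : (p : ℕ) ≠ 0) (h1 : (p : ℕ) ≠ 2 * n + 1) :
    ∃ j, posMap n j = p := by
  by_cases h : (p : ℕ) ≤ n
  · refine ⟨⟨2 * p - 1, by omega⟩, Fin.ext ?_⟩
    rcases posMap_val n ⟨2 * p - 1, by omega⟩ with ⟨h1, h2⟩ | ⟨h1, h2⟩ <;> simp only at h1 h2 <;> omega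
  · refine ⟨⟨2 * (p - n) - 2, by omega⟩, Fin.ext ?_⟩
    rcases posMap_val n ⟨2 * (p - n) - 2, by omega⟩ with ⟨h1, h2⟩ | ⟨h1, h2⟩ <;>
      simp only at h1 h2 <;> omega

lemma theta_iff (n : ℕ) (π : Equiv.Perm (Fin (2 * (n + 1)))) (σ : Equiv.Perm (Fin (2 * n))) :
    ThetaRel n π σ ↔ ∀ j, (σ j : ℕ) + 1 = π (posMap n j) := by
  constructor
  · intro h j
    rcases posMap_val n j with ⟨h1, h2⟩ | ⟨h1, h2⟩
    · have := (h (j / 2 + 1) (by omega) (by omega)).1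
      convert this using 3
      · congr 1; apply Fin.ext; simp only; omega
      · congr 1; apply Fin.ext; simp only; omega
    · have := (h ((j + 1) / 2) (by omega) (by omega)).2
      convert this using 3
      · congr 1; apply Fin.ext; simp only; omega
      · congr 1; apply Fin.ext; simp only; omega
  · intro h i hi hin
    constructor
    · rw [h]
      congr 2
      apply Fin.ext
      rcases posMap_val n ⟨2 * i - 2, by omega⟩ with ⟨h1, h2⟩ | ⟨h1, h2⟩ <;>
        simp only at h1 h2 ⊢ <;> omega
    · rw [h]
      congr 2
      apply Fin.ext
      rcases posMap_val n ⟨2 * i - 1, by omega⟩ with ⟨h1, h2⟩ | ⟨h1, h2⟩ <;>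
        simp only at h1 h2 ⊢ <;> omega

lemma dperm_iff (n : ℕ) (σ : Equiv.Perm (Fin (2 * n))) :
    IsDPerm σ ↔ ∀ j : Fin (2 * n), ((j : ℕ) % 2 = 1 → (σ j : ℕ) ≤ j) ∧
      ((j : ℕ) % 2 = 0 → (j : ℕ) ≤ σ j) := by
  unfold IsDPerm
  refine forall_congr' fun j => ?_
  rw [Nat.even_iff, Nat.odd_iff, Fin.le_def, Fin.le_def]
  constructor
  · rintro ⟨a, b⟩
    exact ⟨fun h => a (by omega), fun h => b (by omega)⟩
  · rintro ⟨a, b⟩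
    exact ⟨fun h => a (by omega), fun h => b (by omega)⟩

lemma exists_sigma (n : ℕ) (π : Equiv.Perm (Fin (2 * (n + 1)))) (h : IsCollapsed (n + 1) π) :
    ∃ σ : Equiv.Perm (Fin (2 * n)), ∀ j, (σ j : ℕ) + 1 = π (posMap n j) := by
  have key : ∀ j, 1 ≤ (π (posMap n j) : ℕ) ∧ (π (posMap n j) : ℕ) ≤ 2 * n := by
    intro j
    have hv := posMap_val n j
    constructor
    · by_contra hc
      have : π (posMap n j) = π ⟨0, by omega⟩ := by
        rw [collapsed_zero n π h]; apply Fin.ext; simp only; omega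
      have := congrArg Fin.val (π.injective this)
      simp only at this
      omega
    · by_contra hc
      have : π (posMap n j) = π ⟨2 * n + 1, by omega⟩ := by
        rw [collapsed_last n π h]; apply Fin.ext; simp only; omega
      have := congrArg Fin.val (π.injective this)
      simp only at this
      omega
  let f : Fin (2 * n) → Fin (2 * n) := fun j =>
    ⟨(π (posMap n j) : ℕ) - 1, by have := key j; omega⟩
  have hf : Function.Injective f := by
    intro a b hab
    have h1 := congrArg Fin.val hab
    simp only [f] at h1
    have := key a
    have := key b
    exact posMap_inj n (π.injective (Fin.ext (by omega)))
  refine ⟨Equiv.ofBijective f (Finite.injective_iff_bijective.1 hf), fun j => ?_⟩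
  have := key j
  simp only [Equiv.ofBijective_apply, f]
  omega

lemma exists_pi (n : ℕ) (σ : Equiv.Perm (Fin (2 * n))) :
    ∃ π : Equiv.Perm (Fin (2 * (n + 1))), (π ⟨0, by omega⟩ : ℕ) = 0 ∧
      (π ⟨2 * n + 1, by omega⟩ : ℕ) = 2 * n + 1 ∧ ∀ j, (σ j : ℕ) + 1 = π (posMap n j) := by
  have hex : ∀ p : Fin (2 * (n + 1)), ∃ q : Fin (2 * (n + 1)),
      ((p : ℕ) = 0 ∧ (q : ℕ) = 0) ∨ ((p : ℕ) = 2 * n + 1 ∧ (q : ℕ) = 2 * n + 1) ∨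
      ∃ j, posMap n j = p ∧ (q : ℕ) = σ j + 1 := by
    intro p
    by_cases h0 : (p : ℕ) = 0
    · exact ⟨p, Or.inl ⟨h0, h0⟩⟩
    by_cases h1 : (p : ℕ) = 2 * n + 1
    · exact ⟨p, Or.inr (Or.inl ⟨h1, h1⟩)⟩
    obtain ⟨j, hj⟩ := posMap_surj n p h0 h1
    exact ⟨⟨σ j + 1, by omega⟩, Or.inr (Or.inr ⟨j, hj, rfl⟩)⟩
  choose f hf using hex
  have hinj : Function.Injective f := by
    intro a b hab
    have hv := congrArg Fin.val hab
    rcases hf a with ⟨h1, h2⟩ | ⟨h1, h2⟩ | ⟨j, h1, h2⟩ <;>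
    rcases hf b with ⟨h3, h4⟩ | ⟨h3, h4⟩ | ⟨k, h3, h4⟩ <;>
    first
    | (apply Fin.ext; omega)
    | (have : σ j = σ k := Fin.ext (by omega)
       rw [← h1, ← h3, σ.injective this])
  refine ⟨Equiv.ofBijective f (Finite.injective_iff_bijective.1 hinj), ?_, ?_, fun j => ?_⟩
  · simp only [Equiv.ofBijective_apply]
    rcases hf ⟨0, by omega⟩ with ⟨h1, h2⟩ | ⟨h1, h2⟩ | ⟨j, h1, h2⟩
    · exact h2
    · simp only at h1; omega
    · have := posMap_val n j
      rw [h1] at this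
      simp only at this; omega
  · simp only [Equiv.ofBijective_apply]
    rcases hf ⟨2 * n + 1, by omega⟩ with ⟨h1, h2⟩ | ⟨h1, h2⟩ | ⟨j, h1, h2⟩
    · simp only at h1; omega
    · exact h2
    · have := posMap_val n j
      rw [h1] at this
      simp only at this; omega
  · simp only [Equiv.ofBijective_apply]
    have := posMap_val n j
    rcases hf (posMap n j) with ⟨h1, h2⟩ | ⟨h1, h2⟩ | ⟨k, h1, h2⟩
    · omega
    · omega
    · rw [h2, posMap_inj n h1]

/-- For every `n ≥ 1`, the map `θ` defined by
`σ_{2i-1} = π_{n+i+1} - 1`, `σ_{2i} = π_{i+1} - 1` (`1 ≤ i ≤ n`) is a bijection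
from the collapsed permutations of `{1, …, 2n+2}` onto the D-permutations of
`{1, …, 2n}`: the image of each collapsed `π` is a (unique) D-permutation, and
every D-permutation arises from exactly one collapsed `π`. -/
theorem theta_bijection (n : ℕ) (hn : 1 ≤ n) :
    (∀ π : Equiv.Perm (Fin (2 * (n + 1))), IsCollapsed (n + 1) π →
      ∃! σ : Equiv.Perm (Fin (2 * n)), IsDPerm σ ∧ ThetaRel n π σ) ∧
    (∀ σ : Equiv.Perm (Fin (2 * n)), IsDPerm σ →
      ∃! π : Equiv.Perm (Fin (2 * (n + 1))), IsCollapsed (n + 1) π ∧ ThetaRel n π σ) := by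
  constructor
  · intro π h
    obtain ⟨σ, hσ⟩ := exists_sigma n π h
    refine ⟨σ, ⟨?_, (theta_iff n π σ).2 hσ⟩, ?_⟩
    · rw [dperm_iff]
      intro j
      have h1 := (collapsed_iff n π).1 h (posMap n j)
      have h2 := hσ j
      have h3 := posMap_val n j
      constructor <;> intro h4 <;> omega
    · rintro τ ⟨-, hτ⟩
      have hτ := (theta_iff n π τ).1 hτ
      ext j
      have := hτ j
      have := hσ j
      omega
  · intro σ h
    obtain ⟨π, h0, hl, hπ⟩ := exists_pi n σ
    refine ⟨π, ⟨?_, (theta_iff n π σ).2 hπ⟩, ?_⟩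
    · rw [collapsed_iff]
      intro p
      by_cases hp0 : (p : ℕ) = 0
      · have hp : p = ⟨0, by omega⟩ := Fin.ext hp0
        rw [hp, h0]; simp
      by_cases hp1 : (p : ℕ) = 2 * n + 1
      · have hp : p = ⟨2 * n + 1, by omega⟩ := Fin.ext hp1
        rw [hp, hl]; simp only; omega
      obtain ⟨j, rfl⟩ := posMap_surj n p hp0 hp1
      have h1 := (dperm_iff n σ).1 h j
      have h2 := hπ j
      have h3 := posMap_val n j
      have h4 := (σ j).isLt
      omega
    · rintro τ ⟨hc, hτ⟩
      have hτ := (theta_iff n τ σ).1 hτ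
      apply Equiv.ext
      intro p
      apply Fin.ext
      by_cases hp0 : (p : ℕ) = 0
      · have hp : p = ⟨0, by omega⟩ := Fin.ext hp0
        rw [hp, h0, collapsed_zero n τ hc]
      by_cases hp1 : (p : ℕ) = 2 * n + 1
      · have hp : p = ⟨2 * n + 1, by omega⟩ := Fin.ext hp1
        rw [hp, hl, collapsed_last n τ hc]
      obtain ⟨j, rfl⟩ := posMap_surj n p hp0 hp1
      rw [← hτ, ← hπ]
end

section
/- For every n ≥ 1 and every subset A ⊆ {1,…,2n}, the number of permutations π ∈ G^I_{2n} whose set of left-to-right minima equals A is equal to the number of D-permutations σ ∈ 𝔇_{2n} whose set of cycle minima equals A. -/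
/-- A permutation of `{1, …, m}` (one-line notation `π_1 ⋯ π_m`, where the
entry at position `i+1` is `(π i : ℕ) + 1`) belongs to `G^I` if every ascent
is odd–even: whenever `π_i < π_{i+1}`, the entry `π_i` is odd and `π_{i+1}` is even. -/
def IsGI {m : ℕ} (π : Equiv.Perm (Fin m)) : Prop :=
  ∀ i j : Fin m, (i : ℕ) + 1 = (j : ℕ) → π i < π j →
    Odd ((π i : ℕ) + 1) ∧ Even ((π j : ℕ) + 1)

/-- The set of left-to-right minima of the one-line notation of `π`:
the values `π_i` that are smaller than every earlier entry. -/
def Lrmin {m : ℕ} (π : Equiv.Perm (Fin m)) : Set (Fin m) :=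
  {v | ∃ i : Fin m, π i = v ∧ ∀ j : Fin m, j < i → v < π j}

/-- The set of cycle minima of `σ`: the elements that are minimal in their cycle. -/
def Cmin {m : ℕ} (σ : Equiv.Perm (Fin m)) : Set (Fin m) :=
  {v | ∀ w : Fin m, σ.SameCycle v w → v ≤ w}

open Equiv

theorem perm_inv_app {m : ℕ} (σ : Perm (Fin m)) (x : Fin m) : σ⁻¹ (σ x) = x := by simp

theorem perm_app_inv {m : ℕ} (σ : Perm (Fin m)) (x : Fin m) : σ (σ⁻¹ x) = x := by simp

theorem sameCycle_induct {m : ℕ} (σ : Equiv.Perm (Fin m)) (r : Fin m → Fin m → Prop)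
    (hr : Equivalence r) (h : ∀ a, r a (σ a)) {a b : Fin m} (hab : σ.SameCycle a b) : r a b := by
  obtain ⟨k, -, rfl⟩ := hab.exists_pow_eq'
  clear hab
  induction k with
  | zero => exact hr.refl _
  | succ k ih => rw [pow_succ']; exact hr.trans ih (h _)

theorem sameCycle_equivalence {m : ℕ} (σ : Equiv.Perm (Fin m)) : Equivalence σ.SameCycle :=
  ⟨fun a => Equiv.Perm.SameCycle.refl σ a, fun h => h.symm, fun h h' => h.trans h'⟩

section hop
variable {m : ℕ}

theorem ins_apply (ρ : Perm (Fin m)) (w o i : Fin m) (ho : ρ o = o) (hi : i ≠ o) :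
    (ρ * swap w o) i = if i = w then o else ρ i := by
  by_cases h : i = w
  · subst h; simp [ho]
  · simp [h, swap_apply_of_ne_of_ne h hi]

theorem ins_inv_apply (ρ : Perm (Fin m)) (w o i : Fin m) (ho : ρ o = o) (hi : i ≠ o) :
    (ρ * swap w o)⁻¹ i = if i = ρ w then o else ρ⁻¹ i := by
  rw [Perm.inv_eq_iff_eq]
  by_cases h : i = ρ w
  · simp [h]
  · have h1 : ρ⁻¹ i ≠ w := fun h' => h (by rw [← h']; simp)
    have h2 : ρ⁻¹ i ≠ o := fun h' => hi (by rw [← ho, ← h']; simp)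
    simp only [h, if_false, Perm.mul_apply, swap_apply_of_ne_of_ne h1 h2]
    simp

theorem cmin_ins (ρ : Perm (Fin m)) (w o : Fin m) (ho : ρ o = o) (hw : w ≠ o)
    (h : w < o ∨ ρ w < o) : Cmin (ρ * swap w o) = Cmin ρ \ {o} := by
  set τ := ρ * swap w o with hτ
  have hτw : τ w = o := by simp [hτ, ho]
  have hτo : τ o = ρ w := by simp [hτ]
  have hwo : τ.SameCycle w o := by
    have := (Perm.SameCycle.refl τ w).apply_right
    rwa [hτw] at this
  have hoρ : τ.SameCycle o (ρ w) := by
    have := (Perm.SameCycle.refl τ o).apply_right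
    rwa [hτo] at this
  have up : ∀ {a b}, ρ.SameCycle a b → τ.SameCycle a b := by
    intro a b hab
    refine sameCycle_induct ρ _ (sameCycle_equivalence τ) ?_ hab
    intro a
    by_cases hao : a = o
    · rw [hao, ho]
    by_cases haw : a = w
    · rw [haw]; exact hwo.trans hoρ
    · have : τ a = ρ a := by rw [hτ, ins_apply ρ w o a ho hao, if_neg haw]
      rw [← this]; exact (Perm.SameCycle.refl τ a).apply_right
  have down : ∀ {a b}, τ.SameCycle a b →
      ρ.SameCycle (if a = o then w else a) (if b = o then w else b) := by
    intro a b hab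
    refine sameCycle_induct τ
      (fun a b => ρ.SameCycle (if a = o then w else a) (if b = o then w else b))
      ⟨fun a => Perm.SameCycle.refl _ _, fun h => h.symm, fun h h' => h.trans h'⟩ ?_ hab
    intro a
    by_cases hao : a = o
    · have : ρ w ≠ o := fun h' => hw (ρ.injective (h'.trans ho.symm))
      rw [hao, hτo, if_pos rfl, if_neg this]
      exact (Perm.SameCycle.refl ρ w).apply_right
    by_cases haw : a = w
    · rw [haw, hτw, if_pos rfl, if_neg hw]
    · have : τ a = ρ a := by rw [hτ, ins_apply ρ w o a ho hao, if_neg haw]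
      have h2 : ρ a ≠ o := fun h' => hao (ρ.injective (h'.trans ho.symm))
      rw [this, if_neg hao, if_neg h2]; exact (Perm.SameCycle.refl ρ a).apply_right
  ext v
  constructor
  · intro hv
    refine ⟨fun x hx => hv x (up hx), ?_⟩
    rintro rfl
    have h1 := hv w hwo.symm
    have h2 := hv _ hoρ
    rcases h with h | h
    · exact absurd h1 (not_le.2 h)
    · exact absurd h2 (not_le.2 h)
  · rintro ⟨hv, hvo⟩ x hx
    have hvo : v ≠ o := hvo
    have h1 := down hx
    rw [if_neg hvo] at h1
    by_cases hxo : x = o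
    · rw [if_pos hxo] at h1
      rw [hxo]
      rcases h with h | h
      · exact (hv _ h1).trans h.le
      · exact (hv _ h1.apply_right).trans h.le
    · rw [if_neg hxo] at h1
      exact hv _ h1

theorem card_cross (ρ : Perm (Fin m)) (o : Fin m) (ho : ρ o = o) :
    Nat.card {w : Fin m // w < o ∧ o < ρ w} = Nat.card {w : Fin m // o < w ∧ ρ w < o} := by
  classical
  rw [Nat.card_eq_fintype_card, Nat.card_eq_fintype_card, Fintype.card_subtype,
    Fintype.card_subtype]
  -- values `x < o` vs arguments with `ρ x < o`
  have h1 : (Finset.univ.filter fun x => ρ x < o).card =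
      (Finset.univ.filter fun x : Fin m => x < o).card := by
    apply Finset.card_bij (fun x _ => ρ x)
    · intro a ha; simpa using ha
    · intro a _ b _ h; exact ρ.injective h
    · intro b hb; exact ⟨ρ⁻¹ b, by simpa using hb, by simp⟩
  have h2 : (Finset.univ.filter fun x : Fin m => x < o).card =
      (Finset.univ.filter fun x : Fin m => x < o ∧ ρ x < o).card +
      (Finset.univ.filter fun x : Fin m => x < o ∧ o < ρ x).card := by
    rw [← Finset.card_union_of_disjoint]
    · congr 1
      ext x
      simp only [Finset.mem_filter, Finset.mem_univ, true_and, Finset.mem_union]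
      have : x < o → ρ x ≠ o := fun h h' => h.ne (ρ.injective (h'.trans ho.symm))
      constructor
      · intro h; rcases lt_or_gt_of_ne (this h) with h' | h' <;> simp [h, h']
      · rintro (h | h) <;> exact h.1
    · rw [Finset.disjoint_filter]; intro x _ h h'; exact absurd h.2 (not_lt.2 h'.2.le)
  have h3 : (Finset.univ.filter fun x : Fin m => ρ x < o).card =
      (Finset.univ.filter fun x : Fin m => x < o ∧ ρ x < o).card +
      (Finset.univ.filter fun x : Fin m => o < x ∧ ρ x < o).card := by
    rw [← Finset.card_union_of_disjoint]
    · congr 1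
      ext x
      simp only [Finset.mem_filter, Finset.mem_univ, true_and, Finset.mem_union]
      have : ρ x < o → x ≠ o := by rintro h rfl; exact h.ne ho
      constructor
      · intro h; rcases lt_or_gt_of_ne (this h) with h' | h' <;> simp [h, h']
      · rintro (h | h) <;> exact h.2
    · rw [Finset.disjoint_filter]; intro x _ h h'; exact absurd h.1 (not_lt.2 h'.1.le)
  omega

/-- removal of `o` from its cycle -/
noncomputable def remEquiv (o : Fin m) (Q Q' : Perm (Fin m) → Prop) (K : Fin m → Fin m → Prop)
    (hK : ∀ w u, K w u → w ≠ o)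
    (hQ : ∀ ρ w, ρ o = o → K w (ρ w) → (Q (ρ * swap w o) ↔ Q' ρ)) :
    {τ : Perm (Fin m) // Q τ ∧ K (τ⁻¹ o) (τ o)} ≃
      (Σ ρ : {ρ : Perm (Fin m) // ρ o = o ∧ Q' ρ}, {w : Fin m // K w (ρ.1 w)}) where
  toFun τ := by
    have e : (τ.1 * swap (τ.1⁻¹ o) o) * swap (τ.1⁻¹ o) o = τ.1 := by
      rw [mul_assoc, swap_mul_self, mul_one]
    have h1 : (τ.1 * swap (τ.1⁻¹ o) o) o = o := by simp
    have h2 : K (τ.1⁻¹ o) ((τ.1 * swap (τ.1⁻¹ o) o) (τ.1⁻¹ o)) := by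
      simpa using τ.2.2
    exact ⟨⟨τ.1 * swap (τ.1⁻¹ o) o, h1, (hQ _ _ h1 h2).1 (by rw [e]; exact τ.2.1)⟩,
      ⟨τ.1⁻¹ o, h2⟩⟩
  invFun p := ⟨p.1.1 * swap p.2.1 o, (hQ _ _ p.1.2.1 p.2.2).2 p.1.2.2, by
    have h1 : (p.1.1 * swap p.2.1 o)⁻¹ o = p.2.1 := by
      rw [Perm.inv_eq_iff_eq]; simp [p.1.2.1]
    rw [h1]; simpa using p.2.2⟩
  left_inv τ := by
    apply Subtype.ext
    simp only
    rw [mul_assoc, swap_mul_self, mul_one]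
  right_inv p := by
    obtain ⟨⟨ρ, h1, h2⟩, w, hw⟩ := p
    have h3 : (ρ * swap w o)⁻¹ o = w := by
      rw [Perm.inv_eq_iff_eq]; simp [h1]
    refine Sigma.ext (Subtype.ext ?_) ?_
    · simp only [h3]
      rw [mul_assoc, swap_mul_self, mul_one]
    · simp only
      have h4 : ρ * swap w o * swap ((ρ * swap w o)⁻¹ o) o = ρ := by
        rw [h3, mul_assoc, swap_mul_self, mul_one]
      refine (Subtype.heq_iff_coe_eq ?_).2 h3
      intro x
      simp only [h4]

theorem card_hop (o : Fin m) (Q Q' : Perm (Fin m) → Prop)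
    (hQ : ∀ ρ w, ρ o = o → (w < o ∧ o < ρ w ∨ o < w ∧ ρ w < o) →
      (Q (ρ * swap w o) ↔ Q' ρ)) :
    Nat.card {τ : Perm (Fin m) // Q τ ∧ (τ⁻¹ o < o ∧ o < τ o)} =
    Nat.card {τ : Perm (Fin m) // Q τ ∧ (o < τ⁻¹ o ∧ τ o < o)} := by
  rw [Nat.card_congr (remEquiv o Q Q' (fun w u => w < o ∧ o < u) (fun w u h => h.1.ne)
      (fun ρ w h h' => hQ ρ w h (Or.inl h'))),
    Nat.card_congr (remEquiv o Q Q' (fun w u => o < w ∧ u < o) (fun w u h => h.1.ne')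
      (fun ρ w h h' => hQ ρ w h (Or.inr h')))]
  classical
  rw [Nat.card_sigma, Nat.card_sigma]
  exact Finset.sum_congr rfl fun ρ _ => card_cross ρ.1 o ρ.2.1

/-- conditions at index i -/
def CondAt (S : Finset (Fin m)) (τ : Perm (Fin m)) (i : Fin m) : Prop :=
  (Even ((i : ℕ) + 1) → τ i ≤ i) ∧ (¬ Even ((i : ℕ) + 1) → i ∈ S → i ≤ τ⁻¹ i) ∧
    (¬ Even ((i : ℕ) + 1) → i ∉ S → i ≤ τ i)

theorem card_split (α : Type) [Finite α] (P R : α → Prop) :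
    Nat.card {a // P a} = Nat.card {a // P a ∧ R a} + Nat.card {a // P a ∧ ¬ R a} := by
  classical
  have := Fintype.ofFinite α
  simp only [Nat.card_eq_fintype_card, Fintype.card_subtype]
  rw [← Finset.filter_filter, ← Finset.filter_filter,
    Finset.card_filter_add_card_filter_not]

theorem card_step (A : Set (Fin m)) (S : Finset (Fin m)) (o : Fin m) (hoS : o ∉ S) :
    Nat.card {τ : Perm (Fin m) // (∀ i, CondAt S τ i) ∧ Cmin τ = A} =
    Nat.card {τ : Perm (Fin m) // (∀ i, CondAt (insert o S) τ i) ∧ Cmin τ = A} := by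
  have hi : ∀ i ≠ o, ∀ τ, CondAt (insert o S) τ i ↔ CondAt S τ i := by
    intro i hi τ; simp [CondAt, hi]
  by_cases hE : Even ((o : ℕ) + 1)
  · have : ∀ τ i, CondAt (insert o S) τ i ↔ CondAt S τ i := by
      intro τ i
      by_cases h : i = o
      · subst h; simp [CondAt, hE]
      · exact hi i h τ
    simp only [this]
  let Q : Perm (Fin m) → Prop := fun τ => (∀ i ≠ o, CondAt S τ i) ∧ Cmin τ = A
  let Q' : Perm (Fin m) → Prop := fun τ => (∀ i ≠ o, CondAt S τ i) ∧ Cmin τ \ {o} = A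
  have key := card_hop o Q Q' (by
    intro ρ w ho hw
    have hwo : w ≠ o := by rcases hw with h | h; exacts [h.1.ne, h.1.ne']
    have hc := cmin_ins ρ w o ho hwo (by rcases hw with h | h; exacts [Or.inl h.1, Or.inr h.2])
    simp only [Q, Q', hc]
    refine and_congr_left' (forall₂_congr fun i hi => ?_)
    have e1 := ins_apply ρ w o i ho hi
    have e2 := ins_inv_apply ρ w o i ho hi
    have c1 : (ρ * swap w o) i ≤ i ↔ ρ i ≤ i := by
      rw [e1]; split_ifs with h
      · subst h
        rcases hw with h | h
        · exact iff_of_false (not_le.2 h.1) (not_le.2 (h.1.trans h.2))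
        · exact iff_of_true h.1.le (h.2.trans h.1).le
      · rfl
    have c2 : i ≤ (ρ * swap w o) i ↔ i ≤ ρ i := by
      rw [e1]; split_ifs with h
      · subst h
        rcases hw with h | h
        · exact iff_of_true h.1.le (h.1.trans h.2).le
        · exact iff_of_false (not_le.2 h.1) (not_le.2 (h.2.trans h.1))
      · rfl
    have c3 : i ≤ (ρ * swap w o)⁻¹ i ↔ i ≤ ρ⁻¹ i := by
      rw [e2]; split_ifs with h
      · subst h
        rw [perm_inv_app]
        rcases hw with h | h
        · exact iff_of_false (not_le.2 h.2) (not_le.2 (h.1.trans h.2))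
        · exact iff_of_true h.2.le (h.2.trans h.1).le
      · rfl
    simp only [CondAt, c1, c2, c3])
  have s1 : ∀ τ, ((∀ i, CondAt S τ i) ∧ Cmin τ = A) ↔ (Q τ ∧ o ≤ τ o) := by
    intro τ
    have : CondAt S τ o ↔ o ≤ τ o := by simp [CondAt, hE, hoS]
    rw [← this]
    constructor
    · rintro ⟨h, h'⟩; exact ⟨⟨fun i _ => h i, h'⟩, h o⟩
    · rintro ⟨⟨h, h'⟩, h''⟩
      refine ⟨fun i => ?_, h'⟩
      by_cases e : i = o
      · exact e ▸ h''
      · exact h i e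
  have s2 : ∀ τ, ((∀ i, CondAt (insert o S) τ i) ∧ Cmin τ = A) ↔ (Q τ ∧ o ≤ τ⁻¹ o) := by
    intro τ
    have : CondAt (insert o S) τ o ↔ o ≤ τ⁻¹ o := by simp [CondAt, hE]
    rw [← this]
    constructor
    · rintro ⟨h, h'⟩; exact ⟨⟨fun i e => (hi i e τ).1 (h i), h'⟩, h o⟩
    · rintro ⟨⟨h, h'⟩, h''⟩
      refine ⟨fun i => ?_, h'⟩
      by_cases e : i = o
      · exact e ▸ h''
      · exact (hi i e τ).2 (h i e)
  simp only [s1, s2]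
  rw [card_split _ (fun τ => Q τ ∧ o ≤ τ o) (fun τ => τ⁻¹ o < o),
    card_split _ (fun τ => Q τ ∧ o ≤ τ⁻¹ o) (fun τ => τ o < o)]
  have k1 : ∀ τ, ((Q τ ∧ o ≤ τ o) ∧ τ⁻¹ o < o) ↔ (Q τ ∧ (τ⁻¹ o < o ∧ o < τ o)) := by
    intro τ
    constructor
    · rintro ⟨⟨a, b⟩, c⟩
      refine ⟨a, c, lt_of_le_of_ne b fun h => c.ne ?_⟩
      rw [Perm.inv_eq_iff_eq]; exact h
    · rintro ⟨a, b, c⟩; exact ⟨⟨a, c.le⟩, b⟩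
  have k2 : ∀ τ, ((Q τ ∧ o ≤ τ⁻¹ o) ∧ τ o < o) ↔ (Q τ ∧ (o < τ⁻¹ o ∧ τ o < o)) := by
    intro τ
    constructor
    · rintro ⟨⟨a, b⟩, c⟩
      refine ⟨a, lt_of_le_of_ne b fun h => c.ne ?_, c⟩
      rw [eq_comm, Perm.inv_eq_iff_eq] at h; exact h.symm
    · rintro ⟨a, b, c⟩; exact ⟨⟨a, b.le⟩, c⟩
  have k3 : ∀ τ, ((Q τ ∧ o ≤ τ o) ∧ ¬ τ⁻¹ o < o) ↔ ((Q τ ∧ o ≤ τ⁻¹ o) ∧ ¬ τ o < o) := by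
    intro τ; rw [not_lt, not_lt]; tauto
  simp only [k1, k2, k3, key]

theorem card_all (A : Set (Fin m)) (S : Finset (Fin m)) :
    Nat.card {τ : Perm (Fin m) // (∀ i, CondAt ∅ τ i) ∧ Cmin τ = A} =
    Nat.card {τ : Perm (Fin m) // (∀ i, CondAt S τ i) ∧ Cmin τ = A} := by
  classical
  induction S using Finset.induction_on with
  | empty => rfl
  | insert o S h ih => rw [ih]; convert card_step A S o h

end hop

section foata
variable {m : ℕ}

/-- prefix minimum -/
def pmin (π : Perm (Fin m)) (i : Fin m) : Fin m :=
  (Finset.univ.filter fun j => j ≤ i).inf' ⟨i, by simp⟩ π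

theorem pmin_le (π : Perm (Fin m)) {i j : Fin m} (h : j ≤ i) : pmin π i ≤ π j :=
  Finset.inf'_le _ (by simpa using h)

theorem pmin_exists (π : Perm (Fin m)) (i : Fin m) : ∃ j ≤ i, pmin π i = π j := by
  obtain ⟨j, hj, h⟩ := Finset.exists_mem_eq_inf' (s := Finset.univ.filter fun j => j ≤ i)
    ⟨i, by simp⟩ π
  exact ⟨j, by simpa using hj, h⟩

theorem le_pmin (π : Perm (Fin m)) {i x : Fin m} (h : ∀ j ≤ i, x ≤ π j) : x ≤ pmin π i := by
  obtain ⟨j, hj, e⟩ := pmin_exists π i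
  rw [e]; exact h j hj

theorem mem_lrmin (π : Perm (Fin m)) (i : Fin m) : π i ∈ Lrmin π ↔ ∀ j < i, π i < π j := by
  constructor
  · rintro ⟨k, hk, h⟩
    rw [π.injective hk] at h; exact h
  · intro h; exact ⟨i, rfl, h⟩

theorem mem_lrmin_iff (π : Perm (Fin m)) (i : Fin m) : π i ∈ Lrmin π ↔ pmin π i = π i := by
  rw [mem_lrmin]
  constructor
  · intro h
    refine le_antisymm (pmin_le π le_rfl) (le_pmin π fun j hj => ?_)
    rcases hj.lt_or_eq with h' | h'
    · exact (h j h').le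
    · rw [h']
  · intro h j hj
    refine lt_of_le_of_ne (h ▸ pmin_le π hj.le) fun e => hj.ne (π.injective e.symm)

theorem pmin_mem (π : Perm (Fin m)) (i : Fin m) : pmin π i ∈ Lrmin π := by
  obtain ⟨j, hj, e⟩ := pmin_exists π i
  rw [e, mem_lrmin_iff]
  refine le_antisymm (pmin_le π le_rfl) (le_pmin π fun k hk => ?_)
  rw [← e]; exact pmin_le π (hk.trans hj)

open Classical in
/-- Foata map at positions -/
noncomputable def fpos (π : Perm (Fin m)) (i : Fin m) : Fin m :=
  if h : ∃ j : Fin m, (i : ℕ) + 1 = j ∧ π j ∉ Lrmin π then π h.choose else pmin π i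

theorem fpos_cases (π : Perm (Fin m)) (i : Fin m) :
    (∃ j : Fin m, (i : ℕ) + 1 = j ∧ π j ∉ Lrmin π ∧ fpos π i = π j) ∨
    ((∀ j : Fin m, (i : ℕ) + 1 = j → π j ∈ Lrmin π) ∧ fpos π i = pmin π i) := by
  by_cases h : ∃ j : Fin m, (i : ℕ) + 1 = j ∧ π j ∉ Lrmin π
  · left
    exact ⟨h.choose, h.choose_spec.1, h.choose_spec.2, by rw [fpos, dif_pos h]⟩
  · right
    refine ⟨?_, by rw [fpos, dif_neg h]⟩
    push Not at h; exact h

theorem fpos_inj (π : Perm (Fin m)) : Function.Injective (fpos π) := by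
  have main : ∀ i j, i < j → fpos π i ≠ fpos π j := by
    intro i j hij e
    rcases fpos_cases π i with ⟨a, ha, ha', ea⟩ | ⟨ha, ea⟩ <;>
    rcases fpos_cases π j with ⟨b, hb, hb', eb⟩ | ⟨hb, eb⟩
    · rw [ea, eb] at e
      have := π.injective e
      subst this; omega
    · rw [ea, eb] at e
      exact ha' (e ▸ pmin_mem π j)
    · rw [ea, eb] at e
      exact hb' (e ▸ pmin_mem π i)
    · rw [ea, eb] at e
      have hlt : (i : ℕ) < j := hij
      let k : Fin m := ⟨i + 1, by omega⟩
      have hk := ha k rfl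
      rw [mem_lrmin] at hk
      obtain ⟨l, hl, el⟩ := pmin_exists π i
      have h1 : π k < π l := hk l (by
        have : (l : ℕ) ≤ i := hl
        show (l : ℕ) < i + 1
        omega)
      have h2 : pmin π j ≤ π k := pmin_le π (by show (i : ℕ) + 1 ≤ j; omega)
      rw [← e, el] at h2
      exact absurd h1 (not_lt.2 h2)
  intro i j e
  rcases lt_trichotomy i j with h | h | h
  · exact absurd e (main i j h)
  · exact h
  · exact absurd e.symm (main j i h)

/-- Foata map -/
noncomputable def foata (π : Perm (Fin m)) : Perm (Fin m) :=
  π⁻¹.trans (Equiv.ofBijective (fpos π) (Finite.injective_iff_bijective.1 (fpos_inj π)))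

theorem foata_apply (π : Perm (Fin m)) (i : Fin m) : foata π (π i) = fpos π i := by
  simp [foata]

theorem pmin_succ (π : Perm (Fin m)) {i j : Fin m} (h : (i : ℕ) + 1 = j) (hj : π j ∉ Lrmin π) :
    pmin π j = pmin π i := by
  refine le_antisymm (le_pmin π fun k hk => pmin_le π ?_) (le_pmin π fun k hk => ?_)
  · have : (k : ℕ) ≤ i := hk
    show (k : ℕ) ≤ j
    omega
  · have hkj : (k : ℕ) ≤ j := hk
    by_cases e : k = j
    · subst e
      obtain ⟨l, hl, el⟩ := pmin_exists π k
      rw [mem_lrmin_iff, el] at hj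
      have : l ≠ k := fun e => hj (by rw [e])
      have hl' : (l : ℕ) ≤ k := hl
      have : (l : ℕ) ≠ k := fun e => this (Fin.ext e)
      exact le_trans (pmin_le π (show (l : ℕ) ≤ i by omega)) (el ▸ pmin_le π le_rfl)
    · have : (k : ℕ) ≠ j := fun h => e (Fin.ext h)
      exact pmin_le π (show (k : ℕ) ≤ i by omega)

theorem cmin_foata (π : Perm (Fin m)) : Cmin (foata π) = Lrmin π := by
  have inv : ∀ {a b}, (foata π).SameCycle a b → pmin π (π⁻¹ a) = pmin π (π⁻¹ b) := by
    intro a b hab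
    refine sameCycle_induct (foata π) (fun a b => pmin π (π⁻¹ a) = pmin π (π⁻¹ b))
      ⟨fun _ => rfl, fun h => h.symm, fun h h' => h.trans h'⟩ ?_ hab
    intro a
    obtain ⟨i, rfl⟩ := π.surjective a
    rw [foata_apply]
    rcases fpos_cases π i with ⟨j, h, h', e⟩ | ⟨h, e⟩
    · rw [e, perm_inv_app, perm_inv_app, pmin_succ π h h']
    · have := pmin_mem π i
      rw [e, perm_inv_app]
      obtain ⟨l, hl, el⟩ := pmin_exists π i
      rw [el] at this ⊢
      rw [perm_inv_app]
      exact ((mem_lrmin_iff π l).1 this).symm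
  have same : ∀ n : ℕ, ∀ i : Fin m, (i : ℕ) = n → (foata π).SameCycle (π i) (pmin π i) := by
    intro n
    induction n with
    | zero =>
      intro i hi
      have : π i ∈ Lrmin π := by
        rw [mem_lrmin]; intro j hj
        have : (j : ℕ) < i := hj
        omega
      rw [(mem_lrmin_iff π i).1 this]
    | succ n ih =>
      intro i hi
      by_cases h : π i ∈ Lrmin π
      · rw [(mem_lrmin_iff π i).1 h]
      · let k : Fin m := ⟨n, by omega⟩
        have hk : (k : ℕ) + 1 = i := hi.symm
        rw [pmin_succ π hk h]
        have e : foata π (π k) = π i := by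
          rw [foata_apply]
          rcases fpos_cases π k with ⟨j, h1, h', e⟩ | ⟨h1, e⟩
          · rw [e, Fin.ext (h1.symm.trans hk)]
          · exact absurd (h1 i hk) h
        rw [← e]
        exact (ih k rfl).apply_left
  ext v
  obtain ⟨i, rfl⟩ := π.surjective v
  rw [mem_lrmin_iff]
  constructor
  · intro h
    exact le_antisymm (pmin_le π le_rfl) (h _ (same _ i rfl))
  · intro h w hw
    have := inv hw
    rw [perm_inv_app, h] at this
    rw [this]
    have h2 := pmin_le π (le_refl (π⁻¹ w))
    rwa [perm_app_inv] at h2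

theorem foata_inj : Function.Injective (foata (m := m)) := by
  intro π π' e
  have hL : Lrmin π = Lrmin π' := by rw [← cmin_foata, ← cmin_foata, e]
  -- key lemma
  have key : ∀ π π' : Perm (Fin m), Lrmin π = Lrmin π' → ∀ i : Fin m,
      (∀ j < i, π j = π' j) → π i ∈ Lrmin π → π' i ∈ Lrmin π' → ¬ π i < π' i := by
    intro π π' hL i hj h h' hlt
    obtain ⟨j, ej⟩ := π.surjective (π' i)
    have h2 : π j ∈ Lrmin π := by rw [ej, hL]; exact h'
    rcases lt_trichotomy j i with c | c | c
    · rw [hj j c] at ej; exact c.ne (π'.injective ej)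
    · rw [c] at ej; exact hlt.ne ej
    · have := (mem_lrmin π j).1 h2 i c
      rw [ej] at this; exact absurd hlt (not_lt.2 this.le)
  have main : ∀ n : ℕ, ∀ i : Fin m, (i : ℕ) = n → π i = π' i := by
    intro n
    induction n using Nat.strong_induction_on with
    | _ n ih =>
    intro i hi
    have hj : ∀ j < i, π j = π' j := fun j hj => ih j (hi ▸ hj) j rfl
    have both : π i ∈ Lrmin π → π' i ∈ Lrmin π' → π i = π' i := fun h h' =>
      le_antisymm (not_lt.1 (key π' π hL.symm i (fun j h => (hj j h).symm) h' h))
        (not_lt.1 (key π π' hL i hj h h'))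
    rcases Nat.eq_zero_or_pos n with h0 | h0
    · apply both <;>
      · rw [mem_lrmin]; intro j hj
        have : (j : ℕ) < i := hj
        omega
    · let k : Fin m := ⟨n - 1, by omega⟩
      have hk : (k : ℕ) + 1 = i := by show n - 1 + 1 = i; omega
      have ek : π k = π' k := hj k (by show n - 1 < i; omega)
      have ef : fpos π k = fpos π' k := by rw [← foata_apply, ← foata_apply, e, ek]
      rcases fpos_cases π k with ⟨a, ha, ha', ea⟩ | ⟨ha, ea⟩ <;>
      rcases fpos_cases π' k with ⟨b, hb, hb', eb⟩ | ⟨hb, eb⟩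
      · have : a = i := Fin.ext (ha.symm.trans hk)
        have : b = i := Fin.ext (hb.symm.trans hk)
        subst_vars
        rw [← ea, ← eb, ef]
      · rw [← ea, ef, eb, hL] at ha'
        exact absurd (pmin_mem π' k) ha'
      · rw [← eb, ← ef, ea, ← hL] at hb'
        exact absurd (pmin_mem π k) hb'
      · exact both (ha i hk) (hb i hk)
  exact Equiv.ext fun i => main i i rfl

theorem isGI_iff (π : Perm (Fin m)) : IsGI π ↔ ∀ i, CondAt Finset.univ (foata π) i := by
  have h1 : (∀ i, CondAt Finset.univ (foata π) i) ↔
      ∀ v, v < foata π v → Odd ((v : ℕ) + 1) ∧ Even ((foata π v : ℕ) + 1) := by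
    constructor
    · intro h v hv
      constructor
      · rw [← Nat.not_even_iff_odd]
        intro hE; exact absurd hv (not_lt.2 ((h v).1 hE))
      · by_contra hE
        have := (h (foata π v)).2.1 hE (Finset.mem_univ _)
        rw [perm_inv_app] at this
        exact absurd hv (not_lt.2 this)
    · intro h i
      refine ⟨fun hE => ?_, fun hE _ => ?_, fun _ h => absurd (Finset.mem_univ _) h⟩
      · by_contra hlt
        have := (h i (not_le.1 hlt)).1
        rw [← Nat.not_even_iff_odd] at this; exact this hE
      · by_contra hlt
        have := (h ((foata π)⁻¹ i) (by rw [perm_app_inv]; exact not_le.1 hlt)).2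
        rw [perm_app_inv] at this; exact hE this
  rw [h1]
  constructor
  · intro h v hv
    obtain ⟨i, rfl⟩ := π.surjective v
    rw [foata_apply] at hv ⊢
    rcases fpos_cases π i with ⟨a, ha, ha', ea⟩ | ⟨ha, ea⟩
    · rw [ea] at hv ⊢; exact h i a ha hv
    · rw [ea] at hv; exact absurd hv (not_lt.2 (pmin_le π le_rfl))
  · intro h i j hij hlt
    have e : foata π (π i) = π j := by
      rw [foata_apply]
      rcases fpos_cases π i with ⟨a, ha, ha', ea⟩ | ⟨ha, ea⟩
      · rw [ea, Fin.ext (ha.symm.trans hij)]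
      · have := (mem_lrmin π j).1 (ha j hij) i (by show (i : ℕ) < j; omega)
        exact absurd hlt (not_lt.2 this.le)
    have := h (π i)
    rw [e] at this
    exact this hlt

end foata

/-- For every `n ≥ 1` and every `A ⊆ {1, …, 2n}`, the number of `π ∈ G^I_{2n}`
with `Lrmin(π) = A` equals the number of D-permutations `σ` with `Cmin(σ) = A`. -/
theorem card_GI_lrmin_eq_card_D_cmin (n : ℕ) (hn : 1 ≤ n) (A : Set (Fin (2 * n))) :
    Nat.card {π : Equiv.Perm (Fin (2 * n)) // IsGI π ∧ Lrmin π = A} =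
      Nat.card {σ : Equiv.Perm (Fin (2 * n)) // IsDPerm σ ∧ Cmin σ = A} := by
  have h1 : ∀ σ : Equiv.Perm (Fin (2 * n)), IsDPerm σ ↔ ∀ i, CondAt ∅ σ i := by
    intro σ; simp [IsDPerm, CondAt]
  simp only [h1]
  rw [card_all A Finset.univ]
  let F : Perm (Fin (2 * n)) ≃ Perm (Fin (2 * n)) :=
    Equiv.ofBijective foata (Finite.injective_iff_bijective.1 foata_inj)
  refine Nat.card_congr (F.subtypeEquiv fun π => ?_)
  show _ ↔ (∀ i, CondAt Finset.univ (foata π) i) ∧ Cmin (foata π) = A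
  rw [isGI_iff, cmin_foata]
end

section
/- For all n ≥ 1, the number of permutations of {1,…,2n} that consist of a single cycle of length 2n and have only even–odd drops equals the Genocchi number g_n = S(2n, n). -/
/-- An E-permutation of `{1, …, m}`: every drop is even–odd, i.e. whenever
`σ(i) < i`, the point `i` is even and the value `σ(i)` is odd (1-indexed). -/
def IsEPerm {m : ℕ} (σ : Equiv.Perm (Fin m)) : Prop :=
  ∀ i : Fin m, σ i < i → Even ((i : ℕ) + 1) ∧ Odd ((σ i : ℕ) + 1)

section
open Equiv Equiv.Perm

def FC {α : Type*} (σ : Perm α) : Prop := ∀ a b, σ.SameCycle a b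

theorem sameCycle_map {α β : Type*} (σ : Perm α) (τ : Perm β) (g : α → β)
    (h : ∀ y, τ.SameCycle (g y) (g (σ y))) {y z : α} (hyz : σ.SameCycle y z) :
    τ.SameCycle (g y) (g z) := by
  obtain ⟨i, rfl⟩ := hyz
  induction i using Int.induction_on with
  | zero => simpa using SameCycle.refl _ _
  | succ i ih =>
    have := h ((σ ^ (i : ℤ)) y)
    rw [← mul_apply, ← zpow_one_add, add_comm] at this
    exact ih.trans this
  | pred i ih =>
    have := h ((σ ^ (-(i : ℤ) - 1)) y)
    rw [← mul_apply, ← zpow_one_add] at this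
    rw [show (1 : ℤ) + (-i - 1) = -i by ring] at this
    exact ih.trans this.symm

theorem FC_inv {α : Type*} {σ : Perm α} (h : FC σ) : FC σ⁻¹ := fun a b => (h a b).inv

theorem FC_congr {α β : Type*} (e : α ≃ β) {σ : Perm α} (h : FC σ) : FC (e.permCongr σ) := by
  intro a b
  have := sameCycle_map σ (e.permCongr σ) e (fun y => ⟨1, by simp⟩) (h (e.symm a) (e.symm b))
  simpa using this

noncomputable def cnt {α : Type*} (R : α → α → Prop) : ℕ :=
  Nat.card {σ : Perm α // FC σ ∧ ∀ i, R i (σ i)}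

theorem ins_none {α : Type*} [DecidableEq α] (a : α) (τ : Perm α) :
    (decomposeOption.symm (some a, τ)) none = some a := by
  simp

theorem ins_some {α : Type*} [DecidableEq α] (a : α) (τ : Perm α) (b : α) :
    (decomposeOption.symm (some a, τ)) (some b) = if τ b = a then none else some (τ b) := by
  simp [swap_apply_def]

theorem FC_ins {α : Type*} [DecidableEq α] (a : α) (τ : Perm α) :
    FC (decomposeOption.symm (some a, τ)) ↔ FC τ := by
  set σ := decomposeOption.symm (some a, τ) with hσ
  have h0 : σ none = some a := ins_none a τ
  have h1 : ∀ b, σ (some b) = if τ b = a then none else some (τ b) := ins_some a τ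
  clear_value σ
  constructor
  · intro h x y
    have := sameCycle_map σ τ (fun o => o.getD a) (fun y => by
      cases y with
      | none => simp [h0, SameCycle.refl]
      | some b =>
        refine ⟨1, ?_⟩
        by_cases hb : τ b = a <;> simp [h1, hb]) (h (some x) (some y))
    simpa using this
  · intro h
    have hs : ∀ x y, σ.SameCycle (some x) (some y) := by
      intro x y
      refine sameCycle_map τ σ some (fun b => ?_) (h x y)
      by_cases hb : τ b = a
      · refine ⟨2, ?_⟩
        rw [zpow_two, mul_apply, h1, if_pos hb, h0, hb]
      · exact ⟨1, by simp [h1, hb]⟩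
    have hn : ∀ x, σ.SameCycle none (some x) := fun x =>
      (show σ.SameCycle none (some a) from ⟨1, by simp [h0]⟩).trans (hs a x)
    intro x y
    cases x <;> cases y
    · exact SameCycle.refl _ _
    · exact hn _
    · exact (hn _).symm
    · exact hs _ _

theorem FC_none_ne {α : Type*} [Nonempty α] (σ : Perm (Option α)) (h : FC σ) : σ none ≠ none := by
  intro h0
  obtain ⟨x⟩ := ‹Nonempty α›
  have := (h none (some x)).eq_of_left h0
  simp at this

theorem cnt_del {α : Type*} [Nonempty α] (R : Option α → Option α → Prop)
    (s : Option α → Prop) (h0 : s none) (hss : ∀ u v, s u → s v → R u v)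
    (hl : ∀ u v w, s u → s v → R u w → R v w) (hr : ∀ u v w, s u → s v → R w u → R w v) :
    Nat.card {σ : Perm (Option α) // FC σ ∧ (∀ i, R i (σ i)) ∧ s (σ none)} =
      Nat.card {a : α // s (some a)} * cnt (fun i j => R (some i) (some j)) := by
  classical
  unfold cnt
  rw [← Nat.card_prod]
  symm
  have key : ∀ a τ, s (some a) → ((∀ i, R i (decomposeOption.symm (some a, τ) i)) ↔
      ∀ i, R (some i) (some (τ i))) := by
    intro a τ ha
    constructor
    · intro h i
      have := h (some i)
      rw [ins_some] at this
      split_ifs at this with hi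
      · rw [hi]; exact hr _ _ _ h0 ha this
      · exact this
    · intro h i
      cases i with
      | none => rw [ins_none]; exact hss _ _ h0 ha
      | some i =>
        rw [ins_some]
        split_ifs with hi
        · have := h i
          rw [hi] at this
          exact hr _ _ _ ha h0 this
        · exact h i
  refine Nat.card_eq_of_bijective (fun p => ⟨decomposeOption.symm (some p.1.1, p.2.1),
    (FC_ins _ _).2 p.2.2.1, (key _ _ p.1.2).2 p.2.2.2, by rw [ins_none]; exact p.1.2⟩) ⟨?_, ?_⟩
  · rintro ⟨⟨a, ha⟩, ⟨τ, hτ⟩⟩ ⟨⟨b, hb⟩, ⟨τ', hτ'⟩⟩ h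
    have h1 := decomposeOption.symm.injective (congrArg Subtype.val h)
    simp only [Prod.mk.injEq, Option.some.injEq] at h1
    obtain ⟨rfl, rfl⟩ := h1
    rfl
  · rintro ⟨σ, h1, h2, h3⟩
    obtain ⟨⟨o, τ⟩, rfl⟩ := decomposeOption.symm.surjective σ
    cases o with
    | none => exact absurd (by simp) (FC_none_ne _ h1)
    | some a =>
      have ha : s (some a) := by rw [ins_none] at h3; exact h3
      exact ⟨⟨⟨a, ha⟩, ⟨τ, (FC_ins _ _).1 h1, (key _ _ ha).1 h2⟩⟩, rfl⟩

def invE {α : Type*} (R : α → α → Prop) (t : Perm α → Prop) :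
    {σ : Perm α // FC σ ∧ (∀ i, R i (σ i)) ∧ t σ} ≃
    {σ : Perm α // FC σ ∧ (∀ i, R (σ i) i) ∧ t σ⁻¹} :=
  (Equiv.inv (Perm α)).subtypeEquiv (fun σ => by
    simp only [Equiv.inv_apply, inv_inv]
    refine ⟨fun h => ⟨FC_inv h.1, fun i => by simpa using h.2.1 (σ⁻¹ i), h.2.2⟩,
      fun h => ⟨by simpa using FC_inv h.1, fun i => by simpa using h.2.1 (σ i), h.2.2⟩⟩)

theorem cnt_inv {α : Type*} (R : α → α → Prop) : cnt (fun i j => R j i) = cnt R := by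
  have := Nat.card_congr (invE R (fun _ => True))
  simpa [cnt] using this.symm

theorem cnt_del' {α : Type*} [Nonempty α] (R : Option α → Option α → Prop)
    (s : Option α → Prop) (h0 : s none) (hss : ∀ u v, s u → s v → R u v)
    (hl : ∀ u v w, s u → s v → R u w → R v w) (hr : ∀ u v w, s u → s v → R w u → R w v) :
    Nat.card {σ : Perm (Option α) // FC σ ∧ (∀ i, R i (σ i)) ∧ s (σ⁻¹ none)} =
      Nat.card {a : α // s (some a)} * cnt (fun i j => R (some i) (some j)) := by
  rw [Nat.card_congr (invE R (fun σ => s (σ⁻¹ none)))]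
  simp only [inv_inv]
  rw [cnt_del (fun i j => R j i) s h0 (fun u v hu hv => hss v u hv hu) hr hl,
    cnt_inv (fun i j => R (some i) (some j))]

theorem cnt_congr {α β : Type*} (e : α ≃ β) (R : β → β → Prop) :
    cnt (fun i j => R (e i) (e j)) = cnt R := by
  refine Nat.card_congr (e.permCongr.subtypeEquiv (fun σ => ?_))
  refine ⟨fun h => ⟨FC_congr e h.1, fun i => by simpa using h.2 (e.symm i)⟩, fun h => ⟨?_, fun i => by simpa using h.2 (e i)⟩⟩
  have := FC_congr e.symm h.1
  convert this using 1
  ext; simp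

/-- the relation at level `r` -/
def Q {α : Type*} (r : ℕ) (κ : α → ℕ) (i j : α) : Prop :=
  κ i < κ j → (κ i < r → Even (κ i)) ∧ (κ j < r → Odd (κ j))

theorem cnt_fact (α : Type*) [Finite α] [Nonempty α] :
    cnt (fun _ _ : α => True) = (Nat.card α - 1).factorial := by
  obtain ⟨n, hn⟩ : ∃ n, Nat.card α = n + 1 := ⟨Nat.card α - 1, by have := Nat.card_pos (α := α); omega⟩
  have e := (Finite.equivFinOfCardEq hn)
  rw [cnt_congr e (fun _ _ => True), hn]
  clear e hn
  induction n with
  | zero =>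
    simp only [cnt, implies_true, and_true]
    have h1 : Subsingleton (Fin (0 + 1)) := inferInstanceAs (Subsingleton (Fin 1))
    have h2 : Subsingleton {σ : Perm (Fin (0+1)) // FC σ} :=
      ⟨fun a b => Subtype.ext (Equiv.ext fun i => Subsingleton.elim _ _)⟩
    have h3 : Nonempty {σ : Perm (Fin (0+1)) // FC σ} :=
      ⟨⟨1, fun a b => by rw [Subsingleton.elim a b]⟩⟩
    simpa using Nat.card_eq_one_iff_unique.2 ⟨h2, h3⟩
  | succ n ih =>
    rw [cnt_congr (finSuccEquiv (n+1)) (fun _ _ => True)]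
    have := cnt_del (α := Fin (n+1)) (fun _ _ => True) (fun _ => True) trivial (by simp) (by simp) (by simp)
    rw [ih] at this
    simp only [implies_true, and_true] at this
    simp only [cnt, implies_true, and_true]
    rw [this]
    simp [Nat.factorial_succ]

/-- the Gandhi functions -/
def V : ℕ → ℤ → ℤ
  | 0, _ => 1
  | r + 1, x => if Even r then x * V r x else x * (V r (x + 1) - V r x)

theorem cnt_split {α : Type*} [Finite α] (R : α → α → Prop) (t : Perm α → Prop) :
    cnt R = Nat.card {σ : Perm α // FC σ ∧ (∀ i, R i (σ i)) ∧ t σ} +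
      Nat.card {σ : Perm α // FC σ ∧ (∀ i, R i (σ i)) ∧ ¬ t σ} := by
  classical
  unfold cnt
  have := Fintype.ofFinite α
  rw [Nat.card_eq_fintype_card, Nat.card_eq_fintype_card, Nat.card_eq_fintype_card,
    Fintype.card_subtype, Fintype.card_subtype, Fintype.card_subtype,
    ← Finset.card_filter_add_card_filter_not (p := t), Finset.filter_filter, Finset.filter_filter]
  simp only [and_assoc]

theorem cnt_main (r : ℕ) : ∀ (α : Type) [Finite α] (κ : α → ℕ) (x : ℕ), 
    Nat.card {i // r ≤ κ i} = x + 1 → (∀ j < r, ∃! i, κ i = j) → 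
    (cnt (Q r κ) : ℤ) = x.factorial * V r (x + 1) := by
  induction r with
  | zero =>
    intro α _ κ x hx _
    have : Q 0 κ = fun _ _ => True := by funext i j; simp [Q]
    have hc : Nat.card α = x + 1 := by
      rw [← hx]; exact Nat.card_congr (Equiv.subtypeUnivEquiv (by simp)).symm
    have : Nonempty α := (Nat.card_pos_iff.1 (by omega)).1
    simp [*, cnt_fact, V]
  | succ r ih =>
    suffices H : ∀ (β : Type) [Finite β] (κ : Option β → ℕ) (x : ℕ), κ none = r →
        (∀ b, κ (some b) ≠ r) →
        Nat.card {i : β // r ≤ κ (some i)} = x + 1 → (∀ j < r, ∃! i, κ (some i) = j) →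
        (cnt (Q (r+1) κ) : ℤ) = x.factorial * V (r+1) (x + 1) by
      intro α _ κ x hx hκ
      classical
      obtain ⟨a, ha, ha'⟩ := hκ r (by omega)
      let e : Option {b // b ≠ a} ≃ α := Equiv.optionSubtypeNe a
      have hen : e none = a := by simp [e]
      have hes : ∀ b, e (some b) = b := fun b => by simp [e]
      rw [← cnt_congr e (Q (r+1) κ)]
      refine H _ (κ ∘ e) x (by simp [hen, ha]) ?_ ?_ ?_
      · intro b hb
        simp only [Function.comp, hes] at hb
        exact b.2 (ha' _ hb)
      · rw [← hx]
        simp only [Function.comp, hes]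
        refine Nat.card_congr ⟨fun i => ⟨i.1.1, ?_⟩, fun i => ⟨⟨i.1, ?_⟩, ?_⟩, fun i => rfl, fun i => rfl⟩
        · have h1 := i.2
          have h2 : κ i.1.1 ≠ r := fun h => i.1.2 (ha' _ h)
          omega
        · rintro h
          have := i.2
          rw [h] at this
          omega
        · have := i.2
          simp only
          omega
      · intro j hj
        obtain ⟨i, hi, hi'⟩ := hκ j (by omega)
        refine ⟨⟨i, ?_⟩, ?_, ?_⟩
        · rintro rfl
          omega
        · simp [hes, hi]
        · intro b hb
          simp only [Function.comp, hes] at hb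
          exact Subtype.ext (hi' _ hb)
    intro β _ κ x hn hs hx hκ
    have hne : Nonempty β := by
      have : Nonempty {i : β // r ≤ κ (some i)} := (Nat.card_pos_iff.1 (by omega)).1
      exact this.elim fun i => ⟨i.1⟩
    have hdel := cnt_del (Q r κ) (fun o => r ≤ κ o) hn.ge
      (by intro u v hu hv; simp only [Q]; intro; constructor <;> intro <;> omega)
      (by intro u v w hu hv; simp only [Q]; intro h h1; constructor <;> intro h2; · omega
          · exact (h (by omega)).2 h2)
      (by intro u v w hu hv; simp only [Q]; intro h h1; constructor <;> intro h2;
          · by_cases hw : κ w < κ u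
            · exact (h hw).1 h2
            · omega
          · omega)
    have hdel' := cnt_del' (Q r κ) (fun o => r ≤ κ o) hn.ge
      (by intro u v hu hv; simp only [Q]; intro; constructor <;> intro <;> omega)
      (by intro u v w hu hv; simp only [Q]; intro h h1; constructor <;> intro h2; · omega
          · exact (h (by omega)).2 h2)
      (by intro u v w hu hv; simp only [Q]; intro h h1; constructor <;> intro h2;
          · by_cases hw : κ w < κ u
            · exact (h hw).1 h2
            · omega
          · omega)
    have ih1 := ih β (κ ∘ some) x hx hκ
    have hQ : (fun i j => Q r κ (some i) (some j)) = Q r (κ ∘ some) := rfl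
    rw [hQ, hx] at hdel hdel'
    by_cases hr : Even r
    · have h : cnt (Q (r+1) κ) = (x + 1) * cnt (Q r (κ ∘ some)) := by
        rw [← hdel', cnt]
        refine Nat.card_congr (Equiv.subtypeEquivRight fun σ => and_congr_right fun hσ => ?_)
        constructor
        · intro h
          constructor
          · intro i hi
            refine ⟨fun h1 => (h i hi).1 (by omega), fun h1 => (h i hi).2 (by omega)⟩
          · by_contra hc
            have hai : σ (σ⁻¹ none) = none := by simp
            have := (h (σ⁻¹ none) (by rw [hai]; omega)).2 (by rw [hai]; omega)
            rw [hai, hn] at this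
            exact (Nat.not_odd_iff_even.2 hr) this
        · rintro ⟨h, h'⟩ i hi
          refine ⟨fun h1 => ?_, fun h1 => ?_⟩
          · by_cases h2 : κ i < r
            · exact (h i hi).1 h2
            · rwa [show κ i = r by omega]
          · by_cases h2 : κ (σ i) < r
            · exact (h i hi).2 h2
            · exfalso
              have h3 : σ i = none := by
                cases h4 : σ i with
                | none => rfl
                | some b => rw [h4] at h1 h2; have := hs b; omega
              have : σ⁻¹ none = i := by rw [← h3]; simp
              rw [this] at h'
              omega
      rw [h]
      push_cast
      rw [ih1, V, if_pos hr]
      ring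
    · have h : cnt (Q r κ) = (x + 1) * cnt (Q r (κ ∘ some)) + cnt (Q (r+1) κ) := by
        rw [cnt_split (Q r κ) (fun σ => r ≤ κ (σ none)), hdel]
        congr 1
        rw [cnt]
        refine Nat.card_congr (Equiv.subtypeEquivRight fun σ => and_congr_right fun hσ => ?_)
        constructor
        · rintro ⟨h, h'⟩ i hi
          refine ⟨fun h1 => ?_, fun h1 => ?_⟩
          · by_cases h2 : κ i < r
            · exact (h i hi).1 h2
            · exfalso
              have h3 : i = none := by
                cases i with
                | none => rfl
                | some b => have := hs b; omega
              rw [h3] at hi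
              omega
          · by_cases h2 : κ (σ i) < r
            · exact (h i hi).2 h2
            · rw [show κ (σ i) = r by omega]
              exact Nat.not_even_iff_odd.1 hr
        · intro h
          constructor
          · intro i hi
            refine ⟨fun h1 => (h i hi).1 (by omega), fun h1 => (h i hi).2 (by omega)⟩
          · intro hc
            have h3 : σ none ≠ none := FC_none_ne σ hσ
            have h4 : κ (σ none) ≠ r := by
              cases h4 : σ none with
              | none => exact absurd h4 h3
              | some b => exact hs b
            have := (h none (by omega)).1 (by omega)
            rw [hn] at this
            exact hr this
      have ih2 := ih (Option β) κ (x+1) (by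
        rw [← hx, ← Finite.card_option]
        classical
        refine Nat.card_congr ⟨fun o => match o with
          | ⟨none, _⟩ => none
          | ⟨some b, h⟩ => some ⟨b, h⟩, fun o => match o with
          | none => ⟨none, hn.ge⟩
          | some b => ⟨some b.1, b.2⟩, ?_, ?_⟩
        · rintro ⟨_ | b, h⟩ <;> rfl
        · rintro (_ | b) <;> rfl) (by
        intro j hj
        obtain ⟨i, hi, hi'⟩ := hκ j hj
        refine ⟨some i, hi, ?_⟩
        rintro (_ | b) hb
        · omega
        · rw [hi' b hb])
      rw [h] at ih2
      push_cast at ih2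
      rw [ih1] at ih2
      rw [V, if_neg hr]
      rw [Nat.factorial_succ] at ih2
      push_cast at ih2
      linear_combination ih2

end

section
open Polynomial

def gf (m : ℕ) (x : ℤ) : ℤ := V (2 * m + 1) x

theorem gf_zero (x : ℤ) : gf 0 x = x := by simp [gf, V]

theorem gf_succ (m : ℕ) (x : ℤ) : gf (m+1) x = x ^ 2 * (gf m (x + 1) - gf m x) := by
  have h1 : Even (2 * m + 2) := ⟨m + 1, by ring⟩
  have h2 : ¬ Even (2 * m + 1) := by simp [parity_simps]
  unfold gf
  rw [show 2 * (m + 1) + 1 = (2 * m + 2) + 1 by ring, V, if_pos h1, V, if_neg h2]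
  ring

noncomputable def fn (g : ℕ → ℤ) : ℤ[X] →ₗ[ℤ] ℤ := (Polynomial.basisMonomials ℤ).constr ℤ g

theorem fn_X_pow (g : ℕ → ℤ) (n : ℕ) : fn g (X ^ n) = g n := by
  have := (Polynomial.basisMonomials ℤ).constr_basis ℤ g n
  rw [Polynomial.coe_basisMonomials] at this
  rw [X_pow_eq_monomial]
  exact this

theorem lin_ext {f g : ℤ[X] →ₗ[ℤ] ℤ} (h : ∀ n : ℕ, f (X ^ n) = g (X ^ n)) (p : ℤ[X]) : f p = g p := by
  have : f = g := by
    apply (Polynomial.basisMonomials ℤ).ext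
    intro n
    rw [Polynomial.coe_basisMonomials]
    simp only [← X_pow_eq_monomial]
    exact h n
  rw [this]

noncomputable def Lam (x : ℤ) : ℤ[X] →ₗ[ℤ] ℤ := fn (fun m => gf m x)

theorem Lam_step (x : ℤ) (p : ℤ[X]) : Lam x ((X + C (x^2)) * p) = x ^ 2 * Lam (x + 1) p := by
  have := lin_ext (f := Lam x ∘ₗ LinearMap.mulLeft ℤ (X + C (x^2))) (g := (x^2) • Lam (x+1)) (fun n => by
    have h : (X + C (x^2)) * X ^ n = X ^ (n+1) + (x^2) • (X ^ n : ℤ[X]) := by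
      rw [smul_eq_C_mul]; ring
    simp only [LinearMap.comp_apply, LinearMap.mulLeft_apply, h, map_add, map_smul, LinearMap.smul_apply]
    simp only [Lam, fn_X_pow, gf_succ, smul_eq_mul]
    ring) p
  simpa using this

noncomputable def PT (x : ℤ) : ℕ → ℤ[X]
  | 0 => 1
  | k + 1 => (X + C (x^2)) * PT (x+1) k

theorem PT_last (k : ℕ) : ∀ x : ℤ, PT x (k+1) = PT x k * (X + C ((x + k)^2)) := by
  induction k with
  | zero => intro x; simp [PT]
  | succ k ih =>
    intro x
    rw [PT, ih, PT]
    push_cast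
    ring_nf

theorem Lam_PT (k : ℕ) : ∀ a : ℕ, (a.factorial : ℤ) ^ 2 * Lam (a + 1) (PT (a + 1) k) =
    ((a + k).factorial : ℤ) ^ 2 * (a + k + 1) := by
  induction k with
  | zero => 
    intro a
    have := fn_X_pow (fun m => gf m (a+1)) 0
    simp only [pow_zero] at this
    simp [PT, Lam, this, gf_zero]
  | succ k ih =>
    intro a
    rw [PT, Lam_step]
    have := ih (a + 1)
    rw [show a + 1 + k = a + (k + 1) by ring, Nat.factorial_succ a] at this
    push_cast at this ⊢
    linear_combination this

def gen : ℕ → ℤ := fun n => if n = 0 then 0 else if n = 1 then 1 else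
  if Even n then (-1) ^ (n / 2) * gf (n / 2 - 1) 1 else 0

noncomputable def LL : ℤ[X] →ₗ[ℤ] ℤ := fn gen

theorem LL_odd (n : ℕ) : LL (X ^ (2 * n + 1)) = if n = 0 then 1 else 0 := by
  rw [LL, fn_X_pow]
  by_cases h : n = 0 <;> simp [gen, h, parity_simps]

theorem LL_even (n : ℕ) : LL (X ^ (2 * n + 2)) = (-1) ^ (n+1) * gf n 1 := by
  rw [LL, fn_X_pow]
  have h : Even (2 * n + 2) := ⟨n + 1, by ring⟩
  have h2 : (2 * n + 2) / 2 = n + 1 := by omega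
  simp [gen, h, h2]

theorem LL_odd' (p : ℤ[X]) : LL (X * p.comp (- X^2)) = p.eval 0 := by
  have := lin_ext (f := LL ∘ₗ LinearMap.mulLeft ℤ X ∘ₗ (compRingHom (- X^2)).toAddMonoidHom.toIntLinearMap)
    (g := Polynomial.leval 0) (fun n => by
    have h : (X : ℤ[X]) * (- X^2) ^ n = ((-1 : ℤ)^n) • X ^ (2 * n + 1) := by
      rw [smul_eq_C_mul, neg_pow]; simp; ring
    simp only [LinearMap.comp_apply, LinearMap.mulLeft_apply, AddMonoidHom.coe_toIntLinearMap, RingHom.toAddMonoidHom_eq_coe, AddMonoidHom.coe_coe, coe_compRingHom_apply, X_pow_comp, h, map_smul, LL_odd]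
    by_cases hn : n = 0 <;> simp [hn]) p
  simpa using this

theorem LL_even' (p : ℤ[X]) : LL (X ^ 2 * p.comp (- X^2)) = - Lam 1 p := by
  have := lin_ext (f := LL ∘ₗ LinearMap.mulLeft ℤ (X^2) ∘ₗ (compRingHom (- X^2)).toAddMonoidHom.toIntLinearMap)
    (g := - Lam 1) (fun n => by
    have h : (X : ℤ[X]) ^ 2 * (- X^2) ^ n = ((-1 : ℤ)^n) • X ^ (2 * n + 2) := by
      rw [smul_eq_C_mul, neg_pow]; simp; ring
    simp only [LinearMap.comp_apply, LinearMap.mulLeft_apply, AddMonoidHom.coe_toIntLinearMap, RingHom.toAddMonoidHom_eq_coe, AddMonoidHom.coe_coe, coe_compRingHom_apply, X_pow_comp, h, map_smul, LL_even, Lam, fn_X_pow, smul_eq_mul, LinearMap.neg_apply]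
    rw [← mul_assoc, pow_succ, ← mul_assoc, ← mul_pow]
    simp) p
  simpa using this

/-- products in `w = X^2+X`, up to sign -/
noncomputable def W : ℕ → ℤ[X]
  | 0 => X * (X + 1)
  | k + 1 => W k * (C (((k : ℤ) + 1) * (k + 2)) - X * (X + 1))

theorem W_eq (k : ℕ) : W k = X * (X + C ((k : ℤ) + 1)) * (PT 1 k).comp (- X ^ 2) := by
  induction k with
  | zero => simp [W, PT]
  | succ k ih =>
    rw [W, ih, PT_last]
    simp
    ring

theorem PT_eval (k : ℕ) : (PT 1 k).eval 0 = (k.factorial : ℤ) ^ 2 := by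
  induction k with
  | zero => simp [PT]
  | succ k ih =>
    rw [PT_last, Nat.factorial_succ]
    simp [ih]
    ring

theorem LL_W (k : ℕ) : LL (W k) = 0 := by
  have : W k = X ^ 2 * (PT 1 k).comp (- X ^ 2) + ((k : ℤ) + 1) • (X * (PT 1 k).comp (- X ^ 2)) := by
    rw [W_eq, smul_eq_C_mul]; ring
  rw [this, map_add, map_smul, LL_odd', LL_even', PT_eval]
  have := Lam_PT k 0
  simp at this
  rw [this, smul_eq_mul]
  ring

theorem LL_wW (m : ℕ) : ∀ k, LL ((X * (X + 1)) ^ m * W k) = 0 := by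
  induction m with
  | zero => intro k; simpa using LL_W k
  | succ m ih =>
    intro k
    have : (X * (X + 1)) ^ (m+1) * W k = (((k : ℤ) + 1) * (k + 2)) • ((X * (X + 1)) ^ m * W k)
      - (X * (X + 1)) ^ m * W (k+1) := by
      rw [W, smul_eq_C_mul]; ring
    rw [this, map_sub, map_smul, ih, ih]
    simp

theorem LL_w (m : ℕ) : LL ((X * (X + 1)) ^ (m + 1)) = 0 := by
  have := LL_wW m 0
  rwa [W, ← pow_succ] at this


def OddRow (S : ℕ → ℕ → ℕ) (m : ℕ) : Prop := ∀ k l, k + l = m + 1 →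
  (S (2 * m + 1) k : ℤ) = (-1)^(m+1) * LL (X ^ (m + 1 + k) * (X+1) ^ l)

def EvenRow (S : ℕ → ℕ → ℕ) (m : ℕ) : Prop := ∀ l k, 1 ≤ k → k + l = m + 2 →
  (S (2 * m + 2) k : ℤ) = (-1)^(m+1) * LL (X ^ (m + 1 + k) * (X+1) ^ l)

theorem even_of_odd (S : ℕ → ℕ → ℕ)
    (hStop : ∀ r k, 1 ≤ r → r + 1 < 2 * k → S r k = 0)
    (hSeven : ∀ m k, 1 ≤ m → 1 ≤ k →
      S (2 * m) k = S (2 * m - 1) k + S (2 * m) (k + 1))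
    (m : ℕ) (h : OddRow S m) : EvenRow S m := by
  intro l
  induction l with
  | zero =>
    intro k hk hkl
    have hk : k = m + 2 := by omega
    subst hk
    rw [hStop _ _ (by omega) (by omega)]
    have := LL_odd (m + 1)
    rw [if_neg (by omega)] at this
    rw [show m + 1 + (m + 2) = 2 * (m + 1) + 1 by ring]
    simp [this]
  | succ l ih =>
    intro k hk hkl
    have h1 := hSeven (m+1) k (by omega) hk
    rw [show 2 * (m + 1) - 1 = 2 * m + 1 by omega, show 2 * (m+1) = 2 * m + 2 by ring] at h1
    rw [h1]
    push_cast
    rw [ih (k+1) (by omega) (by omega), h k l (by omega), ← mul_add, ← map_add]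
    ring_nf

theorem odd_of_even (S : ℕ → ℕ → ℕ)
    (hS0 : ∀ r, 1 ≤ r → S r 0 = 0)
    (hSodd : ∀ m k, 1 ≤ m → 1 ≤ k → k ≤ m + 1 →
      S (2 * m + 1) k = S (2 * m) k + S (2 * m + 1) (k - 1))
    (m : ℕ) (h : EvenRow S m) : OddRow S (m+1) := by
  intro k
  induction k with
  | zero =>
    intro l hl
    rw [hS0 _ (by omega)]
    have := LL_w (m+1)
    rw [mul_pow] at this
    obtain rfl : l = m + 2 := by omega
    simp [show m + 1 + 1 = m + 2 by ring] at this ⊢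
    exact this
  | succ k ih =>
    intro l hl
    have h1 := hSodd (m+1) (k+1) (by omega) (by omega) (by omega)
    rw [h1, Nat.add_sub_cancel]
    have h2 := h l (k+1) (by omega) (by omega)
    have h3 := ih (l+1) (by omega)
    rw [show 2 * (m+1) = 2 * m + 2 by ring] at h3 ⊢
    push_cast
    rw [h2, h3]
    have : (X : ℤ[X]) ^ (m + 1 + 1 + (k + 1)) * (X + 1) ^ l = X ^ (m + 1 + 1 + k) * (X + 1) ^ (l + 1) -
       X ^ (m + 1 + (k + 1)) * (X + 1) ^ l := by ring
    rw [this, map_sub]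
    ring

theorem odd_row (S : ℕ → ℕ → ℕ)
    (hS1 : S 1 1 = 1)
    (hS0 : ∀ r, 1 ≤ r → S r 0 = 0)
    (hStop : ∀ r k, 1 ≤ r → r + 1 < 2 * k → S r k = 0)
    (hSeven : ∀ m k, 1 ≤ m → 1 ≤ k →
      S (2 * m) k = S (2 * m - 1) k + S (2 * m) (k + 1))
    (hSodd : ∀ m k, 1 ≤ m → 1 ≤ k → k ≤ m + 1 →
      S (2 * m + 1) k = S (2 * m) k + S (2 * m + 1) (k - 1))
    (m : ℕ) : OddRow S m := by
  induction m with
  | zero =>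
    intro k l hkl
    have : k = 0 ∧ l = 1 ∨ k = 1 ∧ l = 0 := by omega
    rcases this with ⟨rfl, rfl⟩ | ⟨rfl, rfl⟩
    · have := LL_w 0
      simp at this
      simp [hS0, this]
    · have := LL_even 0
      simp [gf_zero] at this
      simp [hS1, this]
  | succ m ih => exact odd_of_even S hS0 hSodd m (even_of_odd S hStop hSeven m ih)

theorem S_eq_gf (S : ℕ → ℕ → ℕ)
    (hS1 : S 1 1 = 1)
    (hS0 : ∀ r, 1 ≤ r → S r 0 = 0)
    (hStop : ∀ r k, 1 ≤ r → r + 1 < 2 * k → S r k = 0)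
    (hSeven : ∀ m k, 1 ≤ m → 1 ≤ k →
      S (2 * m) k = S (2 * m - 1) k + S (2 * m) (k + 1))
    (hSodd : ∀ m k, 1 ≤ m → 1 ≤ k → k ≤ m + 1 →
      S (2 * m + 1) k = S (2 * m) k + S (2 * m + 1) (k - 1))
    (m : ℕ) : (S (2 * m + 2) (m + 1) : ℤ) = gf m 1 := by
  have h := even_of_odd S hStop hSeven m (odd_row S hS1 hS0 hStop hSeven hSodd m) 1 (m+1) (by omega) (by omega)
  rw [h, show (X : ℤ[X]) ^ (m + 1 + (m + 1)) * (X + 1) ^ 1 = X ^ (2 * (m + 1) + 1) + X ^ (2 * m + 2) by ring,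
    map_add, LL_odd, LL_even, if_neg (by omega), zero_add, ← mul_assoc, ← mul_pow]
  simp


end

/-- For all `n ≥ 1`, the number of permutations of `{1, …, 2n}` consisting of a
single cycle of length `2n` and having only even–odd drops equals the Genocchi
number `g_n = S(2n, n)`, where `S` is the Seidel triangle. -/
theorem card_EC_eq_genocchi
    (S : ℕ → ℕ → ℕ)
    (hS1 : S 1 1 = 1)
    (hS0 : ∀ r, 1 ≤ r → S r 0 = 0)
    (hStop : ∀ r k, 1 ≤ r → r + 1 < 2 * k → S r k = 0)
    (hSeven : ∀ m k, 1 ≤ m → 1 ≤ k →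
      S (2 * m) k = S (2 * m - 1) k + S (2 * m) (k + 1))
    (hSodd : ∀ m k, 1 ≤ m → 1 ≤ k → k ≤ m + 1 →
      S (2 * m + 1) k = S (2 * m) k + S (2 * m + 1) (k - 1))
    (n : ℕ) (hn : 1 ≤ n) :
    Nat.card {σ : Equiv.Perm (Fin (2 * n)) //
        IsEPerm σ ∧ σ.IsCycle ∧ σ.support.card = 2 * n} =
      S (2 * n) n := by
  obtain ⟨m, rfl⟩ : ∃ m, n = m + 1 := ⟨n - 1, by omega⟩
  have hS := S_eq_gf S hS1 hS0 hStop hSeven hSodd m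
  rw [show 2 * (m + 1) = 2 * m + 2 by ring]
  have hm := cnt_main (2 * m + 1) (Fin (2 * m + 2)) (fun i => 2 * m + 1 - i) 0 (by
    rw [Nat.card_eq_one_iff_unique.2]
    refine ⟨⟨fun a b => ?_⟩, ⟨⟨0, by simp⟩⟩⟩
    have := a.2
    have := b.2
    apply Subtype.ext
    apply Fin.ext
    omega) (by
    intro j hj
    refine ⟨⟨2 * m + 1 - j, by omega⟩, by simp only; omega, ?_⟩
    intro i hi
    apply Fin.ext
    simp only at hi ⊢
    omega)
  have : (Nat.card {σ : Equiv.Perm (Fin (2 * m + 2)) //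
        IsEPerm σ ∧ σ.IsCycle ∧ σ.support.card = 2 * m + 2} : ℤ) = S (2 * m + 2) (m + 1) := by
    rw [hS, gf]
    simp only [Nat.factorial_zero, Nat.cast_one, one_mul, Nat.cast_zero, zero_add] at hm
    rw [← hm, cnt]
    congr 1
    refine Nat.card_congr (Equiv.subtypeEquivRight fun σ => ?_)
    rw [and_comm]
    refine and_congr ?_ (forall_congr' fun i => ?_)
    · constructor
      · rintro ⟨hc, hs⟩ a b
        have hu : σ.support = Finset.univ := by
          apply Finset.eq_univ_of_card
          rw [hs, Fintype.card_fin]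
        exact hc.sameCycle (Equiv.Perm.mem_support.1 (by simp [hu])) (Equiv.Perm.mem_support.1 (by simp [hu]))
      · intro h
        have hne : ∀ a, σ a ≠ a := by
          intro a ha
          have h0 := (h a 0).eq_of_left ha
          have h1 := (h a 1).eq_of_left ha
          rw [h0] at h1
          simp at h1
        refine ⟨⟨0, hne 0, fun b _ => h 0 b⟩, ?_⟩
        have hu : σ.support = Finset.univ := by
          ext a; simp [hne]
        rw [hu, Finset.card_univ, Fintype.card_fin]
    · have h1 := i.2
      have h2 := (σ i).2
      simp only [Q, Fin.lt_def, Nat.even_iff, Nat.odd_iff]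
      omega
  exact_mod_cast this
end

section
/- For all n ≥ 1, the number of E-permutations of {1,…,2n} equals the number of permutations in G^I_{2n}, i.e., |ℰ_{2n}| = |G^I_{2n}|; moreover, the number of permutations in ℰ_{2n} whose cycle decomposition consists of a single cycle of length 2n equals the number of permutations in G^I_{2n} whose first letter is 1. -/
/-- The first letter of the one-line notation of `π` is `k`. -/
def FirstIs {m : ℕ} (π : Equiv.Perm (Fin m)) (k : ℕ) : Prop :=
  ∀ i : Fin m, (i : ℕ) = 0 → (π i : ℕ) + 1 = k

open Classical in
noncomputable def fg {m : ℕ} (π : Equiv.Perm (Fin m)) (i : Fin m) : Fin m :=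
  if h : ∃ h : (i : ℕ) + 1 < m, ∃ j ≤ i, π j < π ⟨i + 1, h⟩ then π ⟨i + 1, h.1⟩
  else ((Finset.Iic i).image π).min' ⟨π i, by simp⟩

lemma fg_cases {m : ℕ} (π : Equiv.Perm (Fin m)) (i : Fin m) :
    (∃ k : Fin m, (i : ℕ) + 1 = k ∧ (∃ j ≤ i, π j < π k) ∧ fg π i = π k) ∨
    ((∀ k : Fin m, (i : ℕ) + 1 = k → ∀ j ≤ i, π k ≤ π j) ∧
      ∃ l ≤ i, fg π i = π l ∧ ∀ j ≤ i, π l ≤ π j) := by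
  by_cases h : ∃ h : (i : ℕ) + 1 < m, ∃ j ≤ i, π j < π ⟨i + 1, h⟩
  · left
    refine ⟨⟨i + 1, h.1⟩, rfl, h.2, ?_⟩
    simp only [fg, h, dite_true]
  · right
    have e : fg π i = ((Finset.Iic i).image π).min' ⟨π i, by simp⟩ := by
      simp only [fg, h, dite_false]
    constructor
    · intro k hk j hj
      by_contra hc
      refine h ⟨by omega, j, hj, ?_⟩
      have : (⟨(i : ℕ) + 1, by omega⟩ : Fin m) = k := Fin.ext hk
      rw [this]; exact not_le.mp hc
    · have hm := Finset.min'_mem ((Finset.Iic i).image π) ⟨π i, by simp⟩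
      rw [← e] at hm
      obtain ⟨l, hl, hl2⟩ := Finset.mem_image.mp hm
      refine ⟨l, by simpa using hl, hl2.symm, fun j hj => ?_⟩
      rw [hl2, e]
      apply Finset.min'_le
      exact Finset.mem_image_of_mem _ (by simpa using hj)

lemma fg_inj {m : ℕ} (π : Equiv.Perm (Fin m)) : Function.Injective (fg π) := by
  have key : ∀ i j : Fin m, i < j → fg π i ≠ fg π j := by
    intro i j hij h
    rcases fg_cases π i with ⟨k, hk, ⟨a, ha, hak⟩, e⟩ | ⟨h1, l, hl, e, h2⟩ <;>
    rcases fg_cases π j with ⟨k', hk', ⟨a', ha', hak'⟩, e'⟩ | ⟨h1', l', hl', e', h2'⟩ <;>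
    rw [e, e'] at h <;> have h := π.injective h
    · subst h; omega
    · subst h; exact absurd (h2' a (ha.trans hij.le)) (not_le.mpr hak)
    · subst h; omega
    · subst h
      have hlt : (i : ℕ) + 1 < m := by omega
      have := h1 ⟨i + 1, hlt⟩ rfl l hl
      have h3 := h2' ⟨i + 1, hlt⟩ (by rw [Fin.le_def]; simpa using hij)
      have := π.injective (le_antisymm this h3)
      rw [← this, Fin.le_def] at hl
      simp at hl
  intro i j h
  rcases lt_trichotomy i j with h' | h' | h'
  · exact absurd h (key _ _ h')
  · exact h'
  · exact absurd h.symm (key _ _ h')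

/-- `σ = τ⁻¹` with `τ (π i) = fg π i`. -/
noncomputable def fF {m : ℕ} (π : Equiv.Perm (Fin m)) : Equiv.Perm (Fin m) :=
  (π.symm.trans (Equiv.ofBijective (fg π) (Finite.injective_iff_bijective.mp (fg_inj π)))).symm

lemma fF_apply {m : ℕ} (π : Equiv.Perm (Fin m)) (i : Fin m) : fF π (fg π i) = π i := by
  rw [fF, Equiv.symm_apply_eq]; simp

lemma fF_symm_apply {m : ℕ} (π : Equiv.Perm (Fin m)) (i : Fin m) :
    (fF π).symm (π i) = fg π i := by
  rw [Equiv.symm_apply_eq, fF_apply]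

lemma fF_inj {m : ℕ} : Function.Injective (fF (m := m)) := by
  intro π π' h
  have key : ∀ d : ℕ, ∀ i : Fin m, (i : ℕ) + d = m → π i = π' i := by
    intro d
    induction d using Nat.strong_induction_on with
    | _ d ih =>
    intro i hi
    have later : ∀ j : Fin m, i < j → π j = π' j := fun j hj =>
      ih (m - j) (by omega) j (by omega)
    have pre : ∀ j ≤ i, ∃ j' ≤ i, π' j' = π j := by
      intro j hj
      refine ⟨π'.symm (π j), ?_, by simp⟩
      by_contra hc
      have := later _ (not_le.mp hc)
      rw [Equiv.apply_symm_apply] at this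
      have := π.injective this
      rw [this] at hc; exact hc hj
    have pre' : ∀ j ≤ i, ∃ j' ≤ i, π j' = π' j := by
      intro j hj
      refine ⟨π.symm (π' j), ?_, by simp⟩
      by_contra hc
      have := later _ (not_le.mp hc)
      rw [Equiv.apply_symm_apply] at this
      have := π'.injective this
      rw [← this] at hc; exact hc hj
    have hg : fg π i = fg π' i := by
      rcases fg_cases π i with ⟨k, hk, ⟨a, ha, hak⟩, e⟩ | ⟨h1, l, hl, e, h2⟩ <;>
      rcases fg_cases π' i with ⟨k', hk', ⟨a', ha', hak'⟩, e'⟩ | ⟨h1', l', hl', e', h2'⟩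
      · have : k = k' := Fin.ext (by omega)
        subst this
        rw [e, e', later k (by rw [Fin.lt_def]; omega)]
      · exfalso
        obtain ⟨b, hb, hb2⟩ := pre a ha
        have := h1' k hk b hb
        rw [hb2, ← later k (by rw [Fin.lt_def]; omega)] at this
        exact absurd this (not_le.mpr hak)
      · exfalso
        obtain ⟨b, hb, hb2⟩ := pre' a' ha'
        have := h1 k' hk' b hb
        rw [hb2, later k' (by rw [Fin.lt_def]; omega)] at this
        exact absurd this (not_le.mpr hak')
      · rw [e, e']
        apply le_antisymm
        · obtain ⟨b, hb, hb2⟩ := pre' l' hl'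
          rw [← hb2]; exact h2 b hb
        · obtain ⟨b, hb, hb2⟩ := pre l hl
          rw [← hb2]; exact h2' b hb
    rw [← fF_apply π i, ← fF_apply π' i, hg, h]
  ext i
  rw [key (m - i) i (by omega)]

lemma fF_bij {m : ℕ} : Function.Bijective (fF (m := m)) :=
  Finite.injective_iff_bijective.mp fF_inj

lemma fF_GI {m : ℕ} (π : Equiv.Perm (Fin m)) : IsGI π ↔ IsEPerm (fF π) := by
  constructor
  · intro h y hy
    obtain ⟨i, rfl⟩ := (Finite.injective_iff_bijective.mp (fg_inj π)).2 y
    rw [fF_apply] at hy ⊢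
    rcases fg_cases π i with ⟨k, hk, -, e⟩ | ⟨h1, l, hl, e, h2⟩
    · rw [e] at hy ⊢
      exact (h i k hk hy).symm
    · rw [e] at hy
      exact absurd (h2 i le_rfl) (not_le.mpr hy)
  · intro h i j hij hlt
    rcases fg_cases π i with ⟨k, hk, -, e⟩ | ⟨h1, l, hl, e, h2⟩
    · have : k = j := Fin.ext (by omega)
      subst this
      have := h (fg π i)
      rw [fF_apply, e] at this
      exact (this hlt).symm
    · exact absurd (h1 j hij i le_rfl) (not_le.mpr hlt)

lemma fF_first {k : ℕ} (π : Equiv.Perm (Fin (k + 2))) :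
    FirstIs π 1 ↔ ((fF π).IsCycle ∧ (fF π).support.card = k + 2) := by
  constructor
  · intro h
    have h0 : π 0 = 0 := Fin.ext (by simpa using h 0 rfl)
    have e : fF π = π * (finRotate (k + 2))⁻¹ * π⁻¹ := by
      rw [eq_comm, mul_assoc, ← inv_inj, mul_inv_rev, mul_inv_rev, inv_inv, inv_inv]
      ext x
      obtain ⟨i, rfl⟩ := π.surjective x
      have hs : (fF π)⁻¹ (π i) = fg π i := fF_symm_apply π i
      rw [hs]
      have hpi : π⁻¹ (π i) = i := π.symm_apply_apply i
      simp only [Equiv.Perm.mul_apply, hpi]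
      congr 1
      rcases fg_cases π i with ⟨k', hk, -, e⟩ | ⟨h1, l, hl, e, h2⟩
      · rw [e]
        congr 1
        have hi : i < Fin.last (k + 1) := by rw [Fin.lt_def]; simp; omega
        apply Fin.ext
        rw [coe_finRotate_of_ne_last hi.ne]; exact hk
      · by_cases hi : i = Fin.last (k + 1)
        · subst hi
          rw [finRotate_last, e, h0]
          have := h2 0 (Fin.zero_le _)
          rw [h0] at this
          exact (le_antisymm this (Fin.zero_le _)).symm
        · exfalso
          have hi' : (i : ℕ) ≠ k + 1 := fun hc => hi (Fin.ext (by simpa using hc))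
          have := h1 ⟨i + 1, by omega⟩ rfl 0 (Fin.zero_le _)
          rw [h0] at this
          have := le_antisymm this (Fin.zero_le _)
          rw [← h0] at this
          have := congrArg Fin.val (π.injective this)
          simp at this
    rw [e]
    refine ⟨(isCycle_finRotate.inv).conj, ?_⟩
    rw [Equiv.Perm.card_support_conj, Equiv.Perm.support_inv, support_finRotate]
    simp
  · rintro ⟨hc, hs⟩
    have hfull : (fF π).support = Finset.univ := by
      rw [← Finset.card_eq_iff_eq_univ]; simpa using hs
    by_contra hne
    have h0 : π 0 ≠ 0 := by
      intro h0
      apply hne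
      intro i hi
      have : i = 0 := Fin.ext hi
      rw [this, h0]; simp
    set p := π.symm 0 with hp
    have hpp : π p = 0 := by simp [hp]
    have hp0 : 0 < p := by
      rw [Fin.pos_iff_ne_zero]
      intro h; rw [h] at hpp; exact h0 hpp
    have hstep : ∀ x, π.symm x < p → π.symm ((fF π)⁻¹ x) < p := by
      intro x hx
      obtain ⟨i, rfl⟩ := π.surjective x
      have hs : (fF π)⁻¹ (π i) = fg π i := fF_symm_apply π i
      rw [hs]
      rw [Equiv.symm_apply_apply] at hx
      rcases fg_cases π i with ⟨k', hk, ⟨a, -, ha⟩, e⟩ | ⟨h1, l, hl, e, h2⟩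
      · rw [e, Equiv.symm_apply_apply]
        refine lt_of_le_of_ne (by rw [Fin.le_def]; rw [Fin.lt_def] at hx; omega) ?_
        rintro rfl
        rw [hpp] at ha
        exact absurd ha (Fin.not_lt_zero _)
      · rw [e, Equiv.symm_apply_apply]
        exact lt_of_le_of_lt hl hx
    have hc' := hc.inv
    have hm : ∀ x, (fF π)⁻¹ x ≠ x := by
      intro x
      rw [← Equiv.Perm.mem_support, Equiv.Perm.support_inv, hfull]; simp
    obtain ⟨j, hj⟩ := hc'.exists_pow_eq (hm (π 0)) (hm 0)
    have : ∀ j : ℕ, π.symm (((fF π)⁻¹ ^ j) (π 0)) < p := by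
      intro j
      induction j with
      | zero => simpa using hp0
      | succ j ih => rw [pow_succ', Equiv.Perm.mul_apply]; exact hstep _ ih
    have := this j
    rw [hj] at this
    exact lt_irrefl _ this

/-- For all `n ≥ 1`, `|ℰ_{2n}| = |G^I_{2n}|`; moreover the number of
E-permutations consisting of a single cycle of length `2n` equals the number of
permutations in `G^I_{2n}` whose first letter is `1`. -/
theorem card_E_eq_card_GI (n : ℕ) (hn : 1 ≤ n) :
    Nat.card {σ : Equiv.Perm (Fin (2 * n)) // IsEPerm σ} =
      Nat.card {π : Equiv.Perm (Fin (2 * n)) // IsGI π} ∧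
    Nat.card {σ : Equiv.Perm (Fin (2 * n)) //
        IsEPerm σ ∧ σ.IsCycle ∧ σ.support.card = 2 * n} =
      Nat.card {π : Equiv.Perm (Fin (2 * n)) // IsGI π ∧ FirstIs π 1} := by
  obtain ⟨k, rfl⟩ : ∃ k, n = k + 1 := ⟨n - 1, by omega⟩
  constructor
  · exact (Nat.card_congr ((Equiv.ofBijective fF fF_bij).subtypeEquiv fun π => fF_GI π)).symm
  · exact (Nat.card_congr ((Equiv.ofBijective fF fF_bij).subtypeEquiv fun π =>
      and_congr (fF_GI π) (fF_first (k := 2 * k) π))).symm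
end
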